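/- arXiv:1605.03113 — 2 statements merged into one kernel-verified Lean document; each statement's English description precedes it below -/
import Mathlib

section
/- Let k be an algebraically closed field of characteristic 0, ζ ∈ k a primitive 3rd root of unity, and ε ∈ {1, −1}. Let the 3×3 braiding matrix be q_{11} = −1, q_{12} = ε, q_{13} = 1, q_{21} = −ε, q_{22} = −1, q_{23} = ζ⁻¹, q_{31} = 1, q_{32} = −1, q_{33} = ζ⁻¹ (type ufo(4), second Weyl-groupoid object). Then for every λ₁, λ₂, λ₃, λ₄, λ₅, λ₆ ∈ k, the quotient of the free algebra k⟨y_1,y_2,y_3⟩ by the two-sided ideal generated by y_1² − λ₁, y_2² − λ₂, y_3³ − λ₃, [y_{332}, y_{32}]_c − λ₄, [y_{3321}, y_{321}]_c − λ₅, y_{13}, y_{12}² − λ₆, and [[y_{32}, y_{321}]_c, y_2]_c is a nontrivial algebra. -/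
/-- The `q`-bilinear form `q(α,β) = ∏ i j, (q i j) ^ (α i * β j)` on `ℕⁿ`-degrees. -/
noncomputable def qForm {k : Type*} [Field k] {n : ℕ} (q : Fin n → Fin n → k)
    (α β : Fin n → ℕ) : k :=
  ∏ i : Fin n, ∏ j : Fin n, q i j ^ (α i * β j)

/-- The braided commutator on pairs (homogeneous element, its `ℕⁿ`-degree):
`[u,v]_c = u v − q(deg u, deg v) v u`. -/
noncomputable def bc {k : Type*} [Field k] {n : ℕ} (q : Fin n → Fin n → k)
    (u v : FreeAlgebra k (Fin n) × (Fin n → ℕ)) :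
    FreeAlgebra k (Fin n) × (Fin n → ℕ) :=
  (u.1 * v.1 - qForm q u.2 v.2 • (v.1 * u.1), fun i => u.2 i + v.2 i)

/-- The generator `y i` of the free algebra, together with its degree `e_i`. -/
noncomputable def ygen (k : Type*) [Field k] {n : ℕ} (i : Fin n) :
    FreeAlgebra k (Fin n) × (Fin n → ℕ) :=
  (FreeAlgebra.ι k i, fun j => if j = i then 1 else 0)


namespace Ufo

/-! ### A small verified calculator for matrices over `ℤ[ζ][μ][η]` -/

/-- Computable coefficient operations. -/
class Co (A : Type) where
  zero : A
  add : A → A → A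
  mul : A → A → A
  isz : A → Bool
  ofZ : ℤ → ℤ → A

/-- The pair `(a, b)` stands for `a + b ζ`. -/
instance coZ : Co (ℤ × ℤ) where
  zero := (0, 0)
  add x y := (x.1 + y.1, x.2 + y.2)
  mul x y := (x.1 * y.1 - x.2 * y.2, x.1 * y.2 + x.2 * y.1 - x.2 * y.2)
  isz x := decide (x.1 = 0) && decide (x.2 = 0)
  ofZ a b := (a, b)

section ops
variable {A : Type} [Co A]

def addL : List A → List A → List A
  | [], l => l
  | a :: s, l => match l with
    | [] => a :: s
    | b :: t => Co.add a b :: addL s t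

def smulL (a : A) (l : List A) : List A :=
  match Co.isz a with
  | true => []
  | false => l.map (Co.mul a)

def shiftL (l : List A) : List A :=
  match l with
  | [] => []
  | b :: t => Co.zero :: b :: t

def mulL : List A → List A → List A
  | [], _ => []
  | a :: s, t => addL (smulL a t) (shiftL (mulL s t))

def allz : List A → Bool
  | [] => true
  | a :: s => Co.isz a && allz s

/-- Polynomials in one variable, as coefficient lists. -/
instance coL : Co (List A) where
  zero := []
  add := addL
  mul := mulL
  isz := allz
  ofZ a b := [Co.ofZ a b]

/-- row vector times matrix -/
def vecMat : List A → List (List A) → List A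
  | [], _ => []
  | a :: s, l => match l with
    | [] => []
    | b :: t => addL (smulL a b) (vecMat s t)

def mmul (M N : List (List A)) : List (List A) := M.map (fun r => vecMat r N)

/-- the linear combination `∑ c • (M * N)` -/
def lcomb : List (A × List (List A) × List (List A)) → List (List A)
  | [] => []
  | t :: l => addL ((mmul t.2.1 t.2.2).map (smulL t.1)) (lcomb l)

def lens (n : ℕ) : List (A × List (List A) × List (List A)) → Bool
  | [] => true
  | t :: l => Nat.ble t.2.2.length n && lens n l

def allzM : List (List A) → Bool
  | [] => true
  | a :: s => allz a && allzM s

/-- check that `∑ c • (M * N) = 0` -/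
def chk (l : List (A × List (List A) × List (List A))) : Bool :=
  lens 12 l && allzM (lcomb l)

end ops

section sound
variable {A : Type} [Co A] {K : Type*} [CommRing K]

/-- `ev` is compatible with the coefficient operations. -/
structure Ev (ζ : K) (ev : A → K) : Prop where
  zero : ev Co.zero = 0
  add : ∀ a b, ev (Co.add a b) = ev a + ev b
  mul : ∀ a b, ev (Co.mul a b) = ev a * ev b
  isz : ∀ a, Co.isz a = true → ev a = 0
  ofZ : ∀ a b : ℤ, ev (Co.ofZ a b) = a + b * ζ

def evZ (ζ : K) (x : ℤ × ℤ) : K := x.1 + x.2 * ζ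

theorem evZ_ev (ζ : K) (h : ζ ^ 2 + ζ + 1 = 0) : Ev ζ (evZ ζ) where
  zero := by simp [evZ, Co.zero]
  add a b := by simp only [evZ, Co.add]; push_cast; ring
  mul a b := by
    simp only [evZ, Co.mul]; push_cast
    linear_combination (-(a.2 : K) * b.2) * h
  isz a h := by
    simp only [Co.isz, Bool.and_eq_true, decide_eq_true_eq] at h
    simp [evZ, h.1, h.2]
  ofZ a b := rfl

def evP (ev : A → K) (x : K) : List A → K
  | [] => 0
  | a :: s => ev a + x * evP ev x s

variable {ζ : K} {ev : A → K}

theorem evP_add (h : Ev ζ ev) (x : K) (s t : List A) :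
    evP ev x (addL s t) = evP ev x s + evP ev x t := by
  induction s generalizing t with
  | nil => simp [addL, evP]
  | cons a s ih =>
    cases t with
    | nil => simp [addL, evP]
    | cons b t => simp only [addL, evP, ih, h.add]; ring

theorem evP_smul (h : Ev ζ ev) (x : K) (a : A) (t : List A) :
    evP ev x (smulL a t) = ev a * evP ev x t := by
  unfold smulL
  split
  · next h0 => simp [evP, h.isz a h0]
  · induction t with
    | nil => simp [evP]
    | cons b t ih => simp only [List.map_cons, evP, ih, h.mul]; ring

theorem evP_shift (h : Ev ζ ev) (x : K) (t : List A) :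
    evP ev x (shiftL t) = x * evP ev x t := by
  cases t with
  | nil => simp [shiftL, evP]
  | cons b t => simp [shiftL, evP, h.zero]

theorem evP_ev (h : Ev ζ ev) (x : K) : Ev ζ (evP ev x) where
  zero := rfl
  add := evP_add h x
  mul a b := by
    change evP ev x (mulL a b) = _
    induction a with
    | nil => simp [mulL, evP]
    | cons a s ih =>
      simp only [mulL, evP_add h, evP_smul h, evP_shift h, ih, evP]; ring
  isz a h0 := by
    change allz a = true at h0
    induction a with
    | nil => rfl
    | cons a s ih =>
      simp only [allz, Bool.and_eq_true] at h0
      simp [evP, ih h0.2, h.isz a h0.1]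
  ofZ a b := by
    change evP ev x [Co.ofZ a b] = _
    simp [evP, h.ofZ]

/-- Entries of a list matrix. -/
def ent (ev : A → K) (l : List A) (j : ℕ) : K := ev (l.getD j Co.zero)

theorem ent_nil (h : Ev ζ ev) (j : ℕ) : ent ev [] j = 0 := by simp [ent, h.zero]

theorem ent_add (h : Ev ζ ev) (s t : List A) (j : ℕ) :
    ent ev (addL s t) j = ent ev s j + ent ev t j := by
  induction s generalizing t j with
  | nil => simp [addL, ent_nil h]
  | cons a s ih =>
    cases t with
    | nil => simp [addL, ent_nil h]
    | cons b t =>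
      cases j with
      | zero => simp [addL, ent, h.add]
      | succ j => simpa [addL, ent] using ih t j

theorem ent_smul (h : Ev ζ ev) (a : A) (t : List A) (j : ℕ) :
    ent ev (smulL a t) j = ev a * ent ev t j := by
  unfold smulL
  split
  · next h0 => simp [ent_nil h, h.isz a h0]
  · induction t generalizing j with
    | nil => simp [ent_nil h]
    | cons b t ih =>
      cases j with
      | zero => simp [ent, h.mul]
      | succ j => simpa [ent] using ih j

theorem ent_vecMat (h : Ev ζ ev) (n : ℕ) (s : List A) (N : List (List A)) (hN : N.length ≤ n)
    (j : ℕ) : ent ev (vecMat s N) j =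
      ∑ k ∈ Finset.range n, ent ev s k * ent ev (N.getD k []) j := by
  induction s generalizing N n with
  | nil => simp [vecMat, ent_nil h]
  | cons a s ih =>
    cases N with
    | nil => simp [vecMat, ent_nil h]
    | cons b t =>
      cases n with
      | zero => simp at hN
      | succ n =>
        rw [Finset.sum_range_succ', vecMat, ent_add h, ent_smul h,
          ih n t (by simpa using hN), add_comm]
        simp [ent]

/-- The `12 × 12` matrix given by a list of rows. -/
def toM (ev : A → K) (M : List (List A)) : Matrix (Fin 12) (Fin 12) K :=
  Matrix.of fun i j => ent ev (M.getD i []) j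

theorem toM_mul (h : Ev ζ ev) (M N : List (List A)) (hN : N.length ≤ 12) :
    toM ev (mmul M N) = toM ev M * toM ev N := by
  ext i j
  have h1 : (mmul M N).getD i [] = vecMat (M.getD i []) N := by
    unfold mmul
    by_cases hi : (i : ℕ) < M.length
    · simp [List.getD_eq_getElem?_getD, hi]
    · simp only [not_lt] at hi
      simp [List.getD_eq_getElem?_getD, hi, vecMat]
  rw [Matrix.mul_apply]
  simp only [toM, Matrix.of_apply, h1]
  rw [ent_vecMat h 12 _ _ hN, Finset.sum_range]

theorem toM_add (h : Ev ζ ev) (M N : List (List A)) :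
    toM ev (addL M N) = toM ev M + toM ev N := by
  ext i j
  have h1 : ∀ (M N : List (List A)) (i : ℕ),
      (addL M N).getD i [] = addL (M.getD i []) (N.getD i []) := by
    intro M
    induction M with
    | nil => intro N i; simp [addL]
    | cons a s ih =>
      intro N i
      have h0 : ∀ l : List A, addL l [] = l := by intro l; cases l <;> rfl
      cases N with
      | nil => simp [addL, h0]
      | cons b t =>
        cases i with
        | zero => rfl
        | succ i => simpa [addL] using ih t i
  simp only [toM, Matrix.of_apply, Matrix.add_apply, h1, ent_add h]

theorem toM_smul (h : Ev ζ ev) (a : A) (M : List (List A)) :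
    toM ev (M.map (smulL a)) = ev a • toM ev M := by
  ext i j
  have h1 : (M.map (smulL a)).getD i [] = smulL a (M.getD i []) := by
    have h0 : smulL a ([] : List A) = [] := by unfold smulL; split <;> rfl
    by_cases hi : (i : ℕ) < M.length
    · simp [List.getD_eq_getElem?_getD, hi]
    · simp only [not_lt] at hi
      simp [List.getD_eq_getElem?_getD, hi, h0]
  simp only [toM, Matrix.of_apply, Matrix.smul_apply, h1, ent_smul h, smul_eq_mul]

theorem toM_zero (h : Ev ζ ev) (M : List (List A)) (hM : allzM M = true) : toM ev M = 0 := by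
  have h2 : ∀ l : List A, allz l = true → ∀ j, ent ev l j = 0 := by
    intro l
    induction l with
    | nil => intro _ j; exact ent_nil h j
    | cons a s ih =>
      intro hl j
      simp only [allz, Bool.and_eq_true] at hl
      cases j with
      | zero => simpa [ent] using h.isz a hl.1
      | succ j => simpa [ent] using ih hl.2 j
  have h1 : ∀ (M : List (List A)), allzM M = true → ∀ i, allz (M.getD i []) = true := by
    intro M
    induction M with
    | nil => intro _ i; simp [allz]
    | cons a s ih =>
      intro hl i
      simp only [allzM, Bool.and_eq_true] at hl
      cases i with
      | zero => simpa using hl.1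
      | succ i => simpa using ih hl.2 i
  ext i j
  simp only [toM, Matrix.of_apply, Matrix.zero_apply]
  exact h2 _ (h1 M hM i) j

/-- The value of a linear combination of products. -/
def lval (ev : A → K) : List (A × List (List A) × List (List A)) → Matrix (Fin 12) (Fin 12) K
  | [] => 0
  | t :: l => ev t.1 • (toM ev t.2.1 * toM ev t.2.2) + lval ev l

theorem chk_sound (h : Ev ζ ev) (l : List (A × List (List A) × List (List A)))
    (hl : chk l = true) : lval ev l = 0 := by
  simp only [chk, Bool.and_eq_true] at hl
  rw [← toM_zero h _ hl.2]
  have := hl.1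
  clear hl
  induction l with
  | nil => simp only [lval, lcomb]; ext i j; simp [toM, ent_nil h]
  | cons t l ih =>
    simp only [lens, Bool.and_eq_true, Nat.ble_eq] at this
    rw [lval, lcomb, toM_add h, toM_smul h, toM_mul h _ _ this.1, ih this.2]

end sound

section data
variable {A : Type} [Co A]

/-- identity matrix -/
def idL : List (List A) :=
  (List.range 12).map fun i => (List.range i).map (fun _ => Co.zero) ++ [Co.ofZ 1 0]

/-- All the identities needed from the matrices `y, z, M1, M2`. -/
def chkData (y z M1 M2 s r U1 U2 W1 W2 T1 T2 yy ss : List (List A)) (l3 mu l5 c m4 : A) :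
    List Bool :=
  let p1 : A := Co.ofZ 1 0
  let m1 : A := Co.ofZ (-1) 0
  let zt : A := Co.ofZ 0 1
  let z2 : A := Co.ofZ (-1) (-1)
  let I : List (List A) := idL
  let l3' := Co.mul m1 l3
  let mu' := Co.mul m1 mu
  let l5' := Co.mul m1 l5
  let c' := Co.mul m1 c
  let m4' := Co.mul m1 m4
  [ chk [(p1, y, y), (m1, I, yy)],
    chk [(p1, s, s), (m1, I, ss)],
    chk [(p1, y, z), (p1, z, y), (m1, I, s)],
    chk [(p1, y, s), (z2, s, y), (m1, I, r)],
    chk [(p1, y, M1), (p1, M1, y), (m1, I, U1)],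
    chk [(p1, y, M2), (p1, M2, y), (m1, I, U2)],
    chk [(p1, y, U1), (z2, U1, y), (m1, I, W1)],
    chk [(p1, y, U2), (z2, U2, y), (m1, I, W2)],
    chk [(p1, U1, s), (zt, s, U1), (m1, I, T1)],
    chk [(p1, U2, s), (zt, s, U2), (m1, I, T2)],
    chk [(p1, yy, y), (l3', I, I)],
    chk [(p1, z, z), (mu', I, I)],
    chk [(p1, r, s), (p1, s, r), (l5', I, I)],
    chk [(p1, M1, z), (m1, z, M1)],
    chk [(p1, M2, z), (m1, z, M2)],
    chk [(p1, M1, M2), (c', I, I)],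
    chk [(p1, M2, M1), (c', I, I)],
    chk [(p1, r, U1), (m1, U1, r), (p1, s, W1), (m1, W1, s)],
    chk [(p1, r, U2), (m1, U2, r), (p1, s, W2), (m1, W2, s)],
    chk [(p1, T1, z), (p1, z, T1), (z2, ss, M1), (z2, M1, ss)],
    chk [(p1, T2, z), (p1, z, T2), (z2, ss, M2), (z2, M2, ss)],
    chk [(p1, W1, U2), (p1, U1, W2), (m4', I, I)],
    chk [(p1, W2, U1), (p1, U2, W1), (m4', I, I)],
    chk [(p1, T1, M2), (m1, M1, T2)],
    chk [(p1, T2, M1), (m1, M2, T1)]]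

def allTrue : List Bool → Bool
  | [] => true
  | b :: l => b && allTrue l

end data

/-- The building blocks of the representation. -/
structure Data {K : Type*} [CommRing K] {R : Type*} [Ring R] [Algebra K R] (ζ : K)
    (y z M1 M2 s r U1 U2 W1 W2 T1 T2 : R) (l3 mu l5 c m4 : K) : Prop where
  hs : y * z + z * y = s
  hr : y * s + (-1 - ζ) • (s * y) = r
  hU1 : y * M1 + M1 * y = U1
  hU2 : y * M2 + M2 * y = U2
  hW1 : y * U1 + (-1 - ζ) • (U1 * y) = W1
  hW2 : y * U2 + (-1 - ζ) • (U2 * y) = W2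
  hT1 : U1 * s + ζ • (s * U1) = T1
  hT2 : U2 * s + ζ • (s * U2) = T2
  y3 : y * y * y = l3 • (1 : R)
  zz : z * z = mu • (1 : R)
  rs : r * s + s * r = l5 • (1 : R)
  z1 : M1 * z = z * M1
  z2 : M2 * z = z * M2
  c12 : M1 * M2 = c • (1 : R)
  c21 : M2 * M1 = c • (1 : R)
  c1 : r * U1 + s * W1 = U1 * r + W1 * s
  c2 : r * U2 + s * W2 = U2 * r + W2 * s
  d1 : T1 * z + z * T1 = (1 + ζ) • (s * s * M1 + M1 * (s * s))
  d2 : T2 * z + z * T2 = (1 + ζ) • (s * s * M2 + M2 * (s * s))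
  m12 : W1 * U2 + U1 * W2 = m4 • (1 : R)
  m21 : W2 * U1 + U2 * W1 = m4 • (1 : R)
  t12 : T1 * M2 = M1 * T2
  t21 : T2 * M1 = M2 * T1

theorem toM_id {A : Type} [Co A] {K : Type*} [CommRing K] {ζ : K} {ev : A → K} (h : Ev ζ ev) :
    toM ev (idL : List (List A)) = 1 := by
  have h0 := h.zero
  have h1 : ev (Co.ofZ 1 0) = 1 := by simp [h.ofZ]
  ext i j
  simp only [toM, ent, idL, Matrix.of_apply]
  fin_cases i <;> fin_cases j <;>
    simp [List.range_succ, h0, h1]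

theorem data_of {A : Type} [Co A] {K : Type*} [CommRing K] {ζ : K} {ev : A → K} (h : Ev ζ ev)
    (y z M1 M2 s r U1 U2 W1 W2 T1 T2 yy ss : List (List A)) (l3 mu l5 c m4 : A)
    (hc : allTrue (chkData y z M1 M2 s r U1 U2 W1 W2 T1 T2 yy ss l3 mu l5 c m4) = true) :
    Data ζ (toM ev y) (toM ev z) (toM ev M1) (toM ev M2) (toM ev s) (toM ev r) (toM ev U1)
      (toM ev U2) (toM ev W1) (toM ev W2) (toM ev T1) (toM ev T2)
      (ev l3) (ev mu) (ev l5) (ev c) (ev m4) := by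
  simp only [chkData, allTrue, Bool.and_eq_true, and_true] at hc
  obtain ⟨h1, h2, h3, h4, h5, h6, h7, h8, h9, h10, h11, h12, h13, h14, h15, h16, h17, h18, h19,
    h20, h21, h22, h23, h24, h25⟩ := hc
  replace h1 := chk_sound h _ h1
  replace h2 := chk_sound h _ h2
  replace h3 := chk_sound h _ h3
  replace h4 := chk_sound h _ h4
  replace h5 := chk_sound h _ h5
  replace h6 := chk_sound h _ h6
  replace h7 := chk_sound h _ h7
  replace h8 := chk_sound h _ h8
  replace h9 := chk_sound h _ h9
  replace h10 := chk_sound h _ h10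
  replace h11 := chk_sound h _ h11
  replace h12 := chk_sound h _ h12
  replace h13 := chk_sound h _ h13
  replace h14 := chk_sound h _ h14
  replace h15 := chk_sound h _ h15
  replace h16 := chk_sound h _ h16
  replace h17 := chk_sound h _ h17
  replace h18 := chk_sound h _ h18
  replace h19 := chk_sound h _ h19
  replace h20 := chk_sound h _ h20
  replace h21 := chk_sound h _ h21
  replace h22 := chk_sound h _ h22
  replace h23 := chk_sound h _ h23
  replace h24 := chk_sound h _ h24
  replace h25 := chk_sound h _ h25
  simp only [lval, toM_id h, h.ofZ, h.mul, one_mul, mul_one, Int.cast_one, Int.cast_zero,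
    Int.cast_neg, zero_mul, zero_add, add_zero, one_smul, neg_mul, neg_smul] at *
  have e1 := eq_of_sub_eq_zero ((sub_eq_add_neg _ _).trans h1)
  have e2 := eq_of_sub_eq_zero ((sub_eq_add_neg _ _).trans h2)
  rw [← e1] at h11
  rw [← e2] at h20 h21
  constructor
  · exact sub_eq_zero.1 (Eq.trans (by module) h3)
  · exact sub_eq_zero.1 (Eq.trans (by module) h4)
  · exact sub_eq_zero.1 (Eq.trans (by module) h5)
  · exact sub_eq_zero.1 (Eq.trans (by module) h6)
  · exact sub_eq_zero.1 (Eq.trans (by module) h7)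
  · exact sub_eq_zero.1 (Eq.trans (by module) h8)
  · exact sub_eq_zero.1 (Eq.trans (by module) h9)
  · exact sub_eq_zero.1 (Eq.trans (by module) h10)
  · exact sub_eq_zero.1 (Eq.trans (by module) h11)
  · exact sub_eq_zero.1 (Eq.trans (by module) h12)
  · exact sub_eq_zero.1 (Eq.trans (by module) h13)
  · exact sub_eq_zero.1 (Eq.trans (by module) h14)
  · exact sub_eq_zero.1 (Eq.trans (by module) h15)
  · exact sub_eq_zero.1 (Eq.trans (by module) h16)
  · exact sub_eq_zero.1 (Eq.trans (by module) h17)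
  · exact sub_eq_zero.1 (Eq.trans (by module) h18)
  · exact sub_eq_zero.1 (Eq.trans (by module) h19)
  · exact sub_eq_zero.1 (Eq.trans (by module) h20)
  · exact sub_eq_zero.1 (Eq.trans (by module) h21)
  · exact sub_eq_zero.1 (Eq.trans (by module) h22)
  · exact sub_eq_zero.1 (Eq.trans (by module) h23)
  · exact sub_eq_zero.1 (Eq.trans (by module) h24)
  · exact sub_eq_zero.1 (Eq.trans (by module) h25)

/-- the constant `a + b ζ` -/
def q (a b : ℤ) : ℤ × ℤ := (a, b)

/-- the monomial `(a + b ζ) μ ^ m η ^ e` -/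
def p (m e : ℕ) (a b : ℤ) : List (List (ℤ × ℤ)) :=
  List.replicate m [] ++ [List.replicate e (0, 0) ++ [(a, b)]]

/-- zero -/
def o {A : Type} [Co A] : A := Co.zero



def nT_y : List (List (List (List (ℤ × ℤ)))) := [
  [o, p 0 1 3 3, p 0 0 3 0, o, o, o, p 0 3 2 1, p 0 2 1 2, p 0 1 6 6, p 0 0 6 0, p 1 5 1 2, p 1 4 3 3],
  [o, o, p 0 1 3 3, p 0 0 6 0, o, o, p 0 4 (-1) (-2), o, p 0 2 (1) (-1), o, p 0 0 6 0, p 1 5 (1) (-1)],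
  [o, o, o, o, p 0 0 6 0, o, o, p 0 4 2 1, p 0 3 (1) (-1), o, o, p 0 0 6 0],
  [o, o, o, o, p 0 1 (-3) (-3), p 0 0 3 0, o, p 0 5 (-1) (-2), p 0 4 (-3) (-3), p 0 3 (-2) (-1), p 0 2 (-1) (-2), p 0 1 (-6) (-6)],
  [o, o, o, o, o, p 0 1 (-3) (-3), o, o, p 0 5 (-1) (1), p 0 4 1 2, o, p 0 2 (-1) (1)],
  [o, o, o, o, o, o, o, o, o, o, p 0 4 (-2) (-1), p 0 3 (-1) (1)],
  [p 0 1 6 3, p 0 0 (3) (-3), o, o, o, o, o, p 0 1 (0) (-3), p 0 0 (-3) (-3)],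
  [o, o, p 0 0 (3) (-3), o, o, o, o, o, p 0 1 (0) (-3), p 0 0 (-6) (-6)],
  [o, o, p 0 1 (-6) (-3), o, o, o, o, o, o, o, p 0 0 (-6) (-6)],
  [o, o, o, p 0 1 (-6) (-3), p 0 0 (-3) (3), o, o, o, o, o, p 0 1 0 3, p 0 0 (-3) (-3)],
  [o, o, o, o, o, p 0 0 (-3) (3), o, o, o, o, o, p 0 1 0 3],
  [o, o, o, o, o, p 0 1 6 3]]

def nT_z : List (List (List (List (ℤ × ℤ)))) := [
  [o, o, o, p 1 0 1 0],
  [o, o, o, o, p 1 0 1 0],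
  [o, o, o, o, o, p 1 0 1 0],
  [p 0 0 1 0],
  [o, p 0 0 1 0],
  [o, o, p 0 0 1 0],
  [o, o, o, o, o, o, o, o, o, p 1 0 1 0],
  [o, o, o, o, o, o, o, o, o, o, p 1 0 1 0],
  [o, o, o, o, o, o, o, o, o, o, o, p 1 0 1 0],
  [o, o, o, o, o, o, p 0 0 1 0],
  [o, o, o, o, o, o, o, p 0 0 1 0],
  [o, o, o, o, o, o, o, o, p 0 0 1 0]]

def nT_M1 : List (List (List (List (ℤ × ℤ)))) := [
  [p 0 0 1 0],
  [o, p 0 0 1 0],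
  [o, o, p 0 0 1 0],
  [o, o, o, p 0 0 1 0],
  [o, o, o, o, p 0 0 1 0],
  [o, o, o, o, o, p 0 0 1 0],
  [o, o, o, o, o, o, p 0 0 (-1) (0)],
  [o, o, o, o, o, o, o, p 0 0 (-1) (0)],
  [o, o, o, o, o, o, o, o, p 0 0 (-1) (0)],
  [o, o, o, o, o, o, o, o, o, p 0 0 (-1) (0)],
  [o, o, o, o, o, o, o, o, o, o, p 0 0 (-1) (0)],
  [o, o, o, o, o, o, o, o, o, o, o, p 0 0 (-1) (0)]]

def nT_s : List (List (List (List (ℤ × ℤ)))) := [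
  [o, o, o, o, o, p 1 0 6 0, p 0 0 6 0],
  [p 0 0 6 0, o, o, o, o, o, o, p 0 0 6 0],
  [o, p 0 0 6 0, o, o, o, o, o, o, p 0 0 6 0],
  [o, o, p 0 0 6 0, o, o, o, o, o, o, p 0 0 6 0],
  [o, o, o, p 0 0 6 0, o, o, o, o, o, o, p 0 0 6 0],
  [o, o, o, o, p 0 0 6 0, o, o, o, o, o, o, p 0 0 6 0],
  [o, o, o, o, o, o, o, o, o, o, o, p 1 0 (-6) (-6)],
  [o, o, o, o, o, o, p 0 0 (-6) (-6)],
  [o, o, o, o, o, o, o, p 0 0 (-6) (-6)],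
  [o, o, o, o, o, o, o, o, p 0 0 (-6) (-6)],
  [o, o, o, o, o, o, o, o, o, p 0 0 (-6) (-6)],
  [o, o, o, o, o, o, o, o, o, o, p 0 0 (-6) (-6)]]

def nT_r : List (List (List (List (ℤ × ℤ)))) := [
  [p 0 1 (0) (-18), p 0 0 (-18) (-18), o, o, o, o, p 0 2 (6) (-6), p 0 1 (0) (-18), p 0 0 (-18) (-18), p 1 5 (6) (-6), p 1 4 (6) (-6), p 1 3 (6) (-6)],
  [o, p 0 1 18 0, p 0 0 (-18) (-36), o, o, o, p 0 3 (-6) (-12), p 0 2 (-6) (-12), p 0 1 (0) (-18), p 0 0 (-36) (-36), p 1 5 (-6) (-12), p 1 4 (-6) (-12)],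
  [o, o, p 0 1 18 18, p 0 0 (0) (-36), o, o, p 0 4 (-12) (-6), p 0 3 (-12) (-6), p 0 2 (-12) (-6), o, p 0 0 (-36) (-36), p 1 5 (-12) (-6)],
  [o, o, o, p 0 1 0 18, p 0 0 (18) (-18), o, p 0 5 (-6) (6), p 0 4 (-6) (6), p 0 3 (-6) (6), p 0 2 (-6) (6), p 0 1 0 18, p 0 0 (-18) (-18)],
  [o, o, o, o, p 0 1 (-18) (0), p 0 0 18 0, o, p 0 5 6 12, p 0 4 6 12, p 0 3 6 12, p 0 2 6 12, p 0 1 0 18],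
  [o, o, o, o, o, p 0 1 (-18) (-18), o, o, p 0 5 12 6, p 0 4 12 6, p 0 3 12 6, p 0 2 12 6],
  [p 0 0 (18) (-18), o, o, o, o, p 1 1 18 36, p 0 1 18 18, p 0 0 18 0],
  [p 0 1 (-18) (18), p 0 0 36 18, o, o, o, o, o, p 0 1 0 18, p 0 0 36 18],
  [o, p 0 1 (-36) (-18), p 0 0 18 36, o, o, o, o, o, p 0 1 (-18) (0), p 0 0 36 36],
  [o, o, p 0 1 (-18) (-36), p 0 0 (-18) (18), o, o, o, o, o, p 0 1 (-18) (-18), p 0 0 18 36],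
  [o, o, o, p 0 1 (18) (-18), p 0 0 (-36) (-18), o, o, o, o, o, p 0 1 (0) (-18), p 0 0 0 18],
  [o, o, o, o, p 0 1 36 18, p 0 0 (-18) (-36), o, o, o, o, o, p 0 1 18 0]]

def nT_U1 : List (List (List (List (ℤ × ℤ)))) := [
  [o, p 0 1 6 6, p 0 0 6 0],
  [o, o, p 0 1 6 6, p 0 0 12 0],
  [o, o, o, o, p 0 0 12 0],
  [o, o, o, o, p 0 1 (-6) (-6), p 0 0 6 0],
  [o, o, o, o, o, p 0 1 (-6) (-6)],
  [],
  [o, o, o, o, o, o, o, p 0 1 0 6, p 0 0 6 6],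
  [o, o, o, o, o, o, o, o, p 0 1 0 6, p 0 0 12 12],
  [o, o, o, o, o, o, o, o, o, o, p 0 0 12 12],
  [o, o, o, o, o, o, o, o, o, o, p 0 1 (0) (-6), p 0 0 6 6],
  [o, o, o, o, o, o, o, o, o, o, o, p 0 1 (0) (-6)],
  []]

def nT_W1 : List (List (List (List (ℤ × ℤ)))) := [
  [o, o, p 0 2 18 18, p 0 1 36 0, p 0 0 (0) (-36), o, p 0 5 (-12) (-6), p 0 4 (-12) (-6), p 0 3 (-24) (-12), p 0 2 (-12) (12), o, p 1 6 (6) (-6)],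
  [o, o, o, o, o, p 0 0 (0) (-36), o, p 0 5 6 12, p 0 4 0 18, p 0 3 12 24, p 0 2 12 24],
  [o, o, o, o, o, p 0 1 (-36) (0), o, o, p 0 5 18 18, p 0 4 24 12, p 0 3 24 12, p 0 2 24 12],
  [o, o, o, o, o, p 0 2 18 18, o, o, p 0 6 (6) (-6), p 0 5 (0) (-18), p 0 4 (0) (-18), p 0 3 (-12) (-24)],
  [o, o, o, o, o, o, o, o, o, o, p 0 5 (-6) (-12), p 0 4 (-12) (-6)],
  [o, o, o, o, o, o, o, o, o, o, o, p 0 5 (-6) (6)],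
  [o, p 0 2 18 36, p 0 1 72 36, p 0 0 (36) (-36), o, o, o, o, p 0 2 18 0, p 0 1 (0) (-36), p 0 0 (-36) (-36)],
  [o, o, p 0 2 (-36) (-18), p 0 1 (-36) (36), p 0 0 72 36, o, o, o, o, o, o, p 0 0 (-36) (-36)],
  [o, o, o, o, p 0 1 (-72) (-36), p 0 0 36 72, o, o, o, o, o, p 0 1 0 36],
  [o, o, o, o, p 0 2 18 36, p 0 1 (36) (-36), o, o, o, o, o, p 0 2 18 0],
  [o, o, o, o, o, p 0 2 (-36) (-18)],
  []]

def nT_T1 : List (List (List (List (ℤ × ℤ)))) := [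
  [p 0 1 36 36, p 0 0 36 0],
  [o, p 0 1 0 36, p 0 0 72 36],
  [o, o, p 0 1 (-36) (0), p 0 0 72 72],
  [o, o, o, p 0 1 (-36) (-36), p 0 0 36 72],
  [o, o, o, o, p 0 1 (0) (-36), p 0 0 0 36],
  [o, o, o, o, o, p 0 1 36 0],
  [o, o, o, o, o, o, p 0 1 36 0, p 0 0 (0) (-36)],
  [o, o, o, o, o, o, o, p 0 1 36 36, p 0 0 (36) (-36)],
  [o, o, o, o, o, o, o, o, p 0 1 0 36, p 0 0 72 0],
  [o, o, o, o, o, o, o, o, o, p 0 1 (-36) (0), p 0 0 72 36],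
  [o, o, o, o, o, o, o, o, o, o, p 0 1 (-36) (-36), p 0 0 36 36],
  [o, o, o, o, o, o, o, o, o, o, o, p 0 1 (0) (-36)]]

def nT_yy : List (List (List (List (ℤ × ℤ)))) := [
  [p 0 4 9 9, p 0 3 9 0, p 0 2 (-9) (-18), p 0 1 (-18) (0), p 0 0 0 18, p 1 5 0 9, p 0 5 (3) (-3), p 0 4 9 0, p 0 3 (12) (-3), p 0 2 (6) (-6), p 0 1 18 0, p 0 0 (0) (-18)],
  [p 0 5 (0) (-9), p 0 4 (-9) (-9), p 0 3 (-9) (0), o, o, addL (p 0 0 0 18) (p 1 6 9 0), o, p 0 5 (-9) (-9), p 0 4 (-15) (-12), p 0 3 (-12) (-6), p 0 2 (-18) (-18), p 0 1 (-18) (0)],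
  [o, o, o, o, o, p 0 1 18 0, o, o, p 0 5 (-3) (3), o, p 0 3 (-12) (-6), p 0 2 (-6) (6)],
  [o, o, p 0 5 0 9, p 0 4 9 9, p 0 3 9 0, p 0 2 (-9) (-18), o, o, o, p 0 5 (-3) (3), p 0 4 (-3) (12), p 0 3 12 15],
  [o, o, p 0 6 9 0, p 0 5 (0) (-9), p 0 4 (-9) (-9), p 0 3 (-9) (0), o, o, o, o, p 0 5 9 9, p 0 4 9 0],
  [o, o, o, o, o, o, o, o, o, o, o, p 0 5 (3) (-3)],
  [o, p 0 2 9 18, p 0 1 36 18, p 0 0 (18) (-18), o, o, o, p 0 3 0 9, p 0 2 9 18, p 0 1 18 18, addL (p 0 0 18 0) (p 1 6 0 9), p 1 5 9 9],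
  [o, o, p 0 2 (-9) (9), p 0 1 18 36, p 0 0 54 0, o, o, p 0 4 9 0, p 0 3 (0) (-9), o, o, p 0 0 18 0],
  [o, o, o, o, p 0 1 (-36) (-18), p 0 0 36 18, o, p 0 5 (-9) (-9), p 0 4 (-9) (0), o, o, p 0 1 (-18) (-18)],
  [o, o, o, o, p 0 2 9 18, p 0 1 (-18) (-36), o, p 0 6 0 9, p 0 5 9 9, o, p 0 3 0 9, p 0 2 9 18],
  [o, o, o, o, o, p 0 2 (-9) (9), o, o, o, o, p 0 4 9 0, p 0 3 (0) (-9)],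
  [o, o, o, o, o, o, o, o, o, o, p 0 5 (-9) (-9), p 0 4 (-9) (0)]]

def nT_ss : List (List (List (List (ℤ × ℤ)))) := [
  [o, o, o, o, p 1 0 36 0, o, o, o, o, o, o, p 1 0 (0) (-36)],
  [o, o, o, o, o, p 1 0 36 0, p 0 0 (0) (-36)],
  [p 0 0 36 0, o, o, o, o, o, o, p 0 0 (0) (-36)],
  [o, p 0 0 36 0, o, o, o, o, o, o, p 0 0 (0) (-36)],
  [o, o, p 0 0 36 0, o, o, o, o, o, o, p 0 0 (0) (-36)],
  [o, o, o, p 0 0 36 0, o, o, o, o, o, o, p 0 0 (0) (-36)],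
  [o, o, o, o, o, o, o, o, o, o, p 1 0 0 36],
  [o, o, o, o, o, o, o, o, o, o, o, p 1 0 0 36],
  [o, o, o, o, o, o, p 0 0 0 36],
  [o, o, o, o, o, o, o, p 0 0 0 36],
  [o, o, o, o, o, o, o, o, p 0 0 0 36],
  [o, o, o, o, o, o, o, o, o, p 0 0 0 36]]

def xT_y : List (List (ℤ × ℤ)) := [
  [o, o, q (-1) (0)],
  [q 1 0],
  [o, q 1 0],
  [o, o, o, o, o, q (-1) (0)],
  [o, o, o, q 1 0],
  [o, o, o, o, q 1 0],
  [o, o, o, o, o, o, o, o, q (-1) (0)],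
  [o, o, o, o, o, o, q 1 0],
  [o, o, o, o, o, o, o, q 1 0],
  [o, o, o, o, o, o, o, o, o, o, o, q (-1) (0)],
  [o, o, o, o, o, o, o, o, o, q 1 0],
  [o, o, o, o, o, o, o, o, o, o, q 1 0]]

def xT_z : List (List (ℤ × ℤ)) := [
  [q 1 0],
  [o, q (-1) (0)],
  [o, o, q 1 0],
  [q 0 1, o, o, q (-1) (0)],
  [o, o, o, o, q 1 0],
  [o, o, q 1 0, o, o, q (-1) (0)],
  [o, o, o, o, o, o, q (-1) (0)],
  [o, o, o, o, o, o, o, q 1 0],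
  [o, o, o, o, o, o, o, o, q (-1) (0)],
  [o, o, o, o, o, o, q 0 1, o, o, q 1 0],
  [o, o, o, o, o, o, o, o, o, o, q (-1) (0)],
  [o, o, o, o, o, o, o, o, q 1 0, o, o, q 1 0]]

def xT_M1 : List (List (ℤ × ℤ)) := [
  [o, o, o, o, q 12 0, o, o, o, q 12 0, o, o, q 24 0],
  [o, q (-6) (-6), q 6 0, o, o, q (-12) (0), q (12) (-12)],
  [q 6 0, o, q 6 12, o, o, o, o, q (-12) (0)],
  [q (-6) (-6), o, q 0 3, q (0) (-12), q 0 6, q (0) (-6), q (-6) (-6), o, q (-6) (6), o, q 12 12, q 0 12],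
  [q 3 6, o, q 6 3, o, q (-6) (6), o, q 6 6, q (-6) (0), q (-6) (-6), q (0) (-12), o, q (-12) (-12)],
  [q 6 3, q (0) (-3), q 0 6, q 0 6, o, q 6 0, q (-6) (-6), q (-6) (0), q 12 12, o, q (-12) (12)],
  [o, q (-4) (4), q 8 4, o, o, q (-16) (-8), q 24 0, o, q (-8) (8)],
  [q 12 0, o, q (4) (-4), o, o, o, o, q (-24) (0)],
  [o, q (-8) (-4), o, o, o, o, o, o, q 24 0],
  [q (-2) (2), q 2 4, q (4) (-4), o, q 4 8, q (-4) (4), q (0) (-24), q 8 4, q 4 8, q (-24) (0)],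
  [q (-2) (-4), q 4 2, q 2 4, q (4) (-4), o, q (-4) (-8), q (-4) (-8), o, q (-8) (-4), o, q 24 0],
  [q 4 8, q 4 2, q (-2) (-4), o, q (-12) (0), o, o, q 0 12, q (-24) (0), o, o, q (-24) (0)]]

def xT_M2 : List (List (ℤ × ℤ)) := [
  [q (8) (-8), o, o, o, o, o, o, q 4 8, q (4) (-4), o, o, q (8) (-8)],
  [o, q (-8) (8), o, o, o, o, q (0) (-12), o, q (-4) (-8)],
  [o, o, q (8) (-8), o, o, o, o, q (-4) (4)],
  [q 8 16, q (-4) (-4), q 0 4, q (-8) (8), o, q (0) (-8), q 4 2, q (-4) (-2), q 0 6, o, q (4) (-4), q 4 8],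
  [q 4 8, o, q 4 4, o, q (8) (-8), o, q 4 2, q (-6) (-6), q (-2) (2), q (-4) (-8), o, q (-4) (4)],
  [o, q (0) (-4), q (8) (-8), o, o, q (-8) (8), q (-6) (0), q (-2) (2), q 4 8, o, q 0 12],
  [o, q 0 4, q 4 0, o, o, q (-8) (0), o, o, q 2 4, o, q (-4) (4)],
  [q (4) (-4), o, q (0) (-4), o, o, o, o, q (-4) (-2), q (2) (-2), o, o, q (4) (-4)],
  [o, q (-4) (0), o, o, o, o, q (2) (-2), o, q 6 6],
  [q 0 2, q 2 2, q (0) (-4), o, q 4 4, q 0 4, q 4 2, q (-1) (-2), q 2 1, q (-4) (-8), q 2 4],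
  [q (-2) (-2), q 2 0, q 2 2, q (0) (-4), o, q (-4) (-4), q (-2) (-1), o, q (-2) (2), o, q 0 6],
  [q 4 4, q 2 0, q (-2) (-2), o, q (-4) (4), o, q (-3) (0), q 3 3, q (-2) (-4), q 2 4, o, q (2) (-2)]]

def xT_s : List (List (ℤ × ℤ)) := [
  [o, o, q (-2) (0)],
  [],
  [],
  [o, o, q (-1) (-1), o, o, q 2 0],
  [q 0 1],
  [o, q 1 0],
  [o, o, o, o, o, o, o, o, q 2 0],
  [],
  [],
  [o, o, o, o, o, o, o, o, q (-1) (-1), o, o, q (-2) (0)],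
  [o, o, o, o, o, o, q 0 1],
  [o, o, o, o, o, o, o, q 1 0]]

def xT_r : List (List (ℤ × ℤ)) := [
  [o, q 2 2],
  [o, o, q (-2) (0)],
  [],
  [o, q (-1) (1), o, o, q (-2) (-2)],
  [o, o, q (-2) (-1), o, o, q 2 0],
  [q (-1) (0)],
  [o, o, o, o, o, o, o, q (-2) (-2)],
  [o, o, o, o, o, o, o, o, q 2 0],
  [],
  [o, o, o, o, o, o, o, q (-1) (1), o, o, q 2 2],
  [o, o, o, o, o, o, o, o, q (-2) (-1), o, o, q (-2) (0)],
  [o, o, o, o, o, o, q (-1) (0)]]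

def xT_U1 : List (List (ℤ × ℤ)) := [
  [q (-6) (0), o, q (-6) (-12), q 12 0, o, o, o, q 24 0, o, o, q 24 0],
  [q (-6) (-6), q 6 0, o, o, o, o, o, o, q 0 12, o, o, q 24 0],
  [o, q 0 6, o, o, o, q (-12) (0), q (0) (-12)],
  [q (-6) (-3), q 0 6, q 6 0, o, q (0) (-6), q (-6) (12), q 6 6, q 0 6, q (-6) (-6), q 12 12, q 12 0],
  [q (-6) (-6), q 6 3, q (-3) (-3), q (-6) (-6), q 0 6, q (0) (-6), q (-12) (-6), q (-6) (-6), q (-12) (0), o, o, q 0 24],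
  [q 3 3, q 0 6, o, o, q 0 6, q (0) (-6), q 0 6, q 6 12, o, q (-12) (0), o, q (-12) (-12)],
  [q (-4) (4), q 16 8, o, o, q (-16) (-8), o, o, q (-8) (8), q (-48) (0)],
  [o, o, q (-4) (4), o, o, q (-16) (-8), o, o, q (-8) (8)],
  [q (4) (-4), o, q (4) (-4)],
  [q (-2) (-4), q (0) (-6), q 4 2, q 4 8, q 8 4, o, q 8 4, q (4) (-4), q 24 24, o, o, q 48 0],
  [q 2 4, q 4 8, q 6 0, o, o, q (-8) (8), q (0) (-24), o, q 8 16],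
  [q (2) (-2), q (2) (-2), q (-2) (-4), q (-8) (-4), o, q (-4) (-8), q (-4) (4), q (-24) (0), q (-8) (-4)]]

def xT_W1 : List (List (ℤ × ℤ)) := [
  [o, q (-6) (0), q (-6) (-6), o, o, q 24 12, q (-24) (-12), o, o, q (-24) (-24)],
  [q (-12) (-6), o, q (-6) (-18), q 12 0, o, o, o, q 36 0, o, o, q (0) (-24)],
  [q (0) (-6), q 6 0, o, o, q 12 12, o, o, o, q 12 12, o, o, q 24 0],
  [q (3) (-3), q (-6) (-12), q (-3) (-6), q (-6) (0), q 18 0, q 0 6, q (6) (-6), q (-6) (-6), q 0 6, q (0) (-12), o, q 12 24],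
  [q (-9) (-9), q 0 9, q (6) (-6), q 6 0, q (-6) (-6), q (-6) (6), q 6 12, q 12 18, q (-12) (-18), q 12 12, q 36 0],
  [q (0) (-6), q 6 3, q (-3) (0), q (0) (-6), q (-6) (6), q (0) (-6), q (-6) (-12), q (-6) (-6), q (-18) (0), o, q 0 12, q (-12) (12)],
  [q (-12) (-12), o, q (-12) (0), q 8 16, o, o, q 16 8, q 48 48],
  [q (-4) (4), q 24 12, o, o, q (-8) (8), o, o, q 8 16, q (-48) (0)],
  [o, q (-8) (-4), q 4 8, o, o, q (-16) (-8), o, o, q (-8) (8)],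
  [q (-8) (2), q (-4) (-2), q 4 2, q (4) (-4), o, q 0 12, q (-4) (-8), q (24) (-24), q 12 12, o, q (-48) (-48)],
  [q (2) (-8), q (-6) (-12), q 2 4, q 4 8, q 24 12, o, q 8 4, q (12) (-12), q 48 24, o, o, q 48 0],
  [q (-2) (2), q 2 10, q 10 2, o, q (-4) (4), q (-12) (0), q 24 0, q 4 8, q 0 12]]

def xT_T1 : List (List (ℤ × ℤ)) := [
  [o, q 12 12, q (0) (-12), o, o, q 24 24, q (-24) (0)],
  [o, o, q 12 12, o, o, o, o, q 24 0],
  [o, q (-12) (0), o, o, o, o, o, o, q (0) (-24)],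
  [q 0 6, q (-18) (6), q 12 6, o, q (-12) (-12), q 0 12, q (-12) (-12), q (-24) (-12), q 12 0, q (0) (-24), o, q (0) (-24)],
  [o, q (0) (-6), q 6 24, q (-12) (-12), o, q (-12) (-12), o, q (-24) (0), q (-24) (-12), o, q (-24) (-24)],
  [q (0) (-6), o, q (-6) (-6), o, o, o, o, q (-12) (-12), q 0 12, o, o, q 24 24],
  [q 16 8, o, q 16 8],
  [o, q (-16) (-8)],
  [o, o, q (-8) (8)],
  [q (-4) (-8), q (-4) (-8), q (4) (-4), q (-8) (8), o, q (-8) (8), q 8 16, q 48 48, q 8 16],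
  [q 8 4, q (-16) (-8), q (-4) (-8), o, q 8 16, o, o, q 16 8, q 48 0],
  [o, q (-4) (-8), q (-4) (4), o, o, q (-8) (-16), o, o, q (-16) (-8)]]

def xT_U2 : List (List (ℤ × ℤ)) := [
  [o, o, q (-16) (16), o, o, o, q 4 8, q (8) (-8), o, o, q (8) (-8)],
  [o, o, o, o, o, o, o, o, q 4 8, o, o, q (8) (-8)],
  [o, o, o, o, o, o, q (-4) (-8), o, q (-4) (-8)],
  [q (-4) (-4), q 0 8, q (-16) (-8), o, q (0) (-8), q (16) (-16), q (2) (-2), q 2 4, q (-8) (-10), q (4) (-4), q (4) (-4)],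
  [q 8 16, o, q (-4) (-4), o, o, q (0) (-8), q (-2) (-4), q (-6) (0), q (-4) (4), o, o, q 8 16],
  [q 4 4, q (8) (-8), q 4 4, o, o, o, q 2 4, q (-2) (2), q 4 2, q (-4) (4), o, q (-4) (4)],
  [q 0 4, q 8 0, o, o, q (-8) (0), o, q (-2) (2), q 2 4, q (-6) (-6), q (-4) (4)],
  [o, o, q 0 4, o, o, q (-8) (0), q (-4) (-2), q (2) (-2), q 2 4],
  [q (0) (-4), o, q (0) (-4), o, o, o, o, q 2 4, o, o, o, q (4) (-4)],
  [q (-2) (-2), q (-2) (-4), q 2 0, q 4 4, q 4 0, o, q (2) (-2), q (-1) (-2), q (-2) (2), o, o, q 2 10],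
  [q 2 2, q 4 4, q (2) (-2), o, o, q 0 8, q 4 2, q (-3) (0), q 4 2, q (-4) (-2), q 2 4],
  [q (0) (-2), q (0) (-2), q (-2) (-2), q (-4) (0), o, q (-4) (-4), q 1 2, q (-2) (-4), q 1 2, o, q 2 4, q (-2) (-4)]]

def xT_W2 : List (List (ℤ × ℤ)) := [
  [o, q 32 16, o, o, o, o, q (-12) (0), o, q 0 12, q (-16) (-8)],
  [o, o, q (-16) (16), o, o, o, q 4 8, q (12) (-12), o, o, q (-8) (-16)],
  [o, o, o, o, o, o, o, q (-4) (4), q 8 4, o, o, q (8) (-8)],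
  [q (4) (-4), q 0 24, q (-4) (-8), q (-8) (0), q (-32) (-16), o, q (0) (-6), q 0 6, o, q (-4) (-8), o, q 12 0],
  [q (-4) (-4), q 0 12, q (-24) (0), o, q (-8) (-8), q (16) (-16), q 8 4, q 10 8, q (-6) (-12), q (4) (-4), q (12) (-12)],
  [q (-8) (8), q (0) (-4), q (-4) (0), o, o, q (0) (-8), q (2) (-2), q (-8) (-4), q (-6) (6), o, q 8 4, q 0 12],
  [q (-8) (-4), o, q (-4) (4), q 8 8, o, o, q (2) (-2), q (-2) (2), q (-4) (-2), o, o, q (-12) (0)],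
  [q 0 4, q 12 0, o, o, q 0 8, o, q (-6) (0), q 4 2, q (-8) (-10), q (-4) (4)],
  [o, q (-4) (0), q 4 4, o, o, q (-8) (0), q (-2) (-4), q (2) (-2), q 2 4, o, q (-8) (-4)],
  [q (-2) (4), q (-2) (0), q 2 0, q (0) (-4), o, q 4 8, q (-2) (-1), q 6 6, q 3 0, o, q (6) (-6), q 2 4],
  [q (-2) (-6), q (-6) (-6), q 2 2, q 4 4, q 12 0, o, q 5 1, q (-3) (-6), q 0 6, q (2) (-2), o, q 0 6],
  [q 0 2, q 4 6, q (4) (-2), o, q 0 4, q (-4) (4), q 2 4, q (-2) (-1), q 3 3, q (-2) (-4), q 0 6]]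

def xT_T2 : List (List (ℤ × ℤ)) := [
  [o, o, o, o, o, o, q (-8) (8), o, q (-8) (8)],
  [o, o, o, o, o, o, o, q (8) (-8)],
  [o, o, o, o, o, o, o, o, q (-8) (-16)],
  [q 0 8, q 32 16, q 0 8, o, o, o, q (-8) (-4), q (-4) (-8), q (-12) (-12), q (-8) (-16), o, q (-16) (-8)],
  [o, q (0) (-8), q (16) (-16), o, o, o, q (4) (-4), q (-8) (8), q (-4) (-8), o, q (-16) (-8)],
  [o, o, q (-8) (-8), o, o, o, o, q (-4) (4), q 4 8, o, o, q 16 8],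
  [q 8 0, o, q 8 0, o, o, o, o, q (-8) (-4), q 4 8, o, o, q 16 8],
  [o, q (-8) (0), o, o, o, o, o, o, q (-8) (-4)],
  [o, o, q 0 8, o, o, o, o, q (4) (-4)],
  [q (-4) (-4), q (-4) (-4), q (0) (-4), q 0 8, o, q 0 8, q 4 2, q (-4) (10), q (8) (-2), o, q 8 4, q (-4) (-8)],
  [q 4 0, q (-8) (0), q (-4) (-4), o, q 8 8, o, o, q (2) (-2), q 10 14, q 8 4, o, q 8 4],
  [o, q (-4) (-4), q 0 4, o, o, q (-8) (-8), q (-2) (-4), o, q (-2) (2)]]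

def xT_yy : List (List (ℤ × ℤ)) := [
  [o, q (-1) (0)],
  [o, o, q (-1) (0)],
  [q 1 0],
  [o, o, o, o, q (-1) (0)],
  [o, o, o, o, o, q (-1) (0)],
  [o, o, o, q 1 0],
  [o, o, o, o, o, o, o, q (-1) (0)],
  [o, o, o, o, o, o, o, o, q (-1) (0)],
  [o, o, o, o, o, o, q 1 0],
  [o, o, o, o, o, o, o, o, o, o, q (-1) (0)],
  [o, o, o, o, o, o, o, o, o, o, o, q (-1) (0)],
  [o, o, o, o, o, o, o, o, o, q 1 0]]

def xT_ss : List (List (ℤ × ℤ)) := [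
  [],
  [],
  [],
  [o, q 2 0],
  [o, o, q (0) (-2)],
  [],
  [],
  [],
  [],
  [o, o, o, o, o, o, o, q (-2) (0)],
  [o, o, o, o, o, o, o, o, q 0 2],
  []]

def wT_y : List (List (ℤ × ℤ)) := [
  [o, o, o, q 2 1, q (-1) (-1)],
  [o, o, o, o, o, q (-1) (-1)],
  [o, o, o, o, o, q (1) (-1)],
  [o, q 1 0, q 1 1],
  [o, o, q 1 0],
  [],
  [o, o, o, o, o, o, o, o, o, o, q (0) (-2)],
  [o, o, o, o, o, o, q 1 0, o, o, o, o, q 1 0],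
  [o, o, o, o, o, o, q 1 0, o, o, o, o, q 3 0],
  [],
  [],
  [o, o, o, o, o, o, o, o, o, q 1 0, q 0 1]]

def wT_z : List (List (ℤ × ℤ)) := [
  [q 1 0],
  [o, q 1 0],
  [o, o, q (-1) (0)],
  [o, o, o, q (-1) (0)],
  [o, o, o, o, q 1 0],
  [o, o, o, o, o, q 1 0],
  [o, o, o, o, o, o, q 1 0],
  [o, o, o, o, o, o, o, q 1 0],
  [o, o, o, o, o, o, o, o, q (-1) (0)],
  [o, o, o, o, o, o, o, o, o, q (-1) (0)],
  [o, o, o, o, o, o, o, o, o, o, q 1 0],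
  [o, o, o, o, o, o, o, o, o, o, o, q 1 0]]

def wT_M1 : List (List (ℤ × ℤ)) := [
  [o, o, o, o, o, o, q 1 0],
  [o, o, o, o, o, o, o, q 1 0],
  [o, o, o, o, o, o, o, o, q (-1) (0)],
  [o, o, o, o, o, o, o, o, o, q (-1) (0)],
  [o, o, o, o, o, o, o, o, o, o, q 1 0],
  [o, o, o, o, o, o, o, o, o, o, o, q 1 0],
  [q 1 0],
  [o, q 1 0],
  [o, o, q (-1) (0)],
  [o, o, o, q (-1) (0)],
  [o, o, o, o, q 1 0],
  [o, o, o, o, o, q 1 0]]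

def wT_s : List (List (ℤ × ℤ)) := [
  [o, o, o, o, q (-2) (-2)],
  [o, o, o, o, o, q (-2) (-2)],
  [],
  [o, o, q (-2) (-2)],
  [],
  [],
  [o, o, o, o, o, o, o, o, o, o, q (0) (-4)],
  [o, o, o, o, o, o, q 2 0, o, o, o, o, q 2 0],
  [],
  [],
  [],
  [o, o, o, o, o, o, o, o, o, o, q 0 2]]

def wT_r : List (List (ℤ × ℤ)) := [
  [o, o, q (-2) (-2)],
  [],
  [],
  [o, o, o, o, o, q 0 2],
  [],
  [],
  [],
  [o, o, o, o, o, o, o, o, o, q (-2) (-2), q (-2) (-2)],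
  [o, o, o, o, o, o, o, o, o, o, q 0 2],
  [],
  [],
  []]

def wT_U1 : List (List (ℤ × ℤ)) := [
  [o, o, o, o, o, o, o, o, o, q (-2) (-1), q (-1) (-3)],
  [o, o, o, o, o, o, q 1 0, o, o, o, o, q (0) (-1)],
  [o, o, o, o, o, o, q (-1) (0), o, o, o, o, q (-2) (-1)],
  [o, o, o, o, o, o, o, q 1 0, q (-1) (-1)],
  [o, o, o, o, o, o, o, o, q (-1) (0)],
  [o, o, o, o, o, o, o, o, o, q 1 0, q 0 1],
  [o, o, o, q 2 1, q (-1) (-3)],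
  [q 1 0, o, o, o, o, q (0) (-1)],
  [q 1 0, o, o, o, o, q 2 1],
  [o, q (-1) (0), q (-1) (-1)],
  [o, o, q 1 0],
  [o, o, o, q (-1) (0), q 0 1]]

def wT_W1 : List (List (ℤ × ℤ)) := [
  [o, o, o, o, o, o, o, q 2 1, q (0) (-1)],
  [o, o, o, o, o, o, o, o, o, q (-2) (-1), q (-1) (-1)],
  [o, o, o, o, o, o, o, o, o, q 2 1, q 1 1],
  [o, o, o, o, o, o, q (-1) (-1), o, o, o, o, q (-2) (-1)],
  [o, o, o, o, o, o, q 0 1, o, o, o, o, q 1 2],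
  [],
  [o, q (-1) (-2), q (-1) (-2)],
  [o, o, o, q (0) (-1), q (-1) (-1)],
  [o, o, o, q (-2) (-1), q (-1) (1)],
  [o, o, o, o, o, q 1 1],
  [o, o, o, o, o, q (-2) (-1)],
  [o, q 0 1, q 0 1]]

def wT_T1 : List (List (ℤ × ℤ)) := [
  [o, o, o, o, o, o, o, o, q (-2) (0)],
  [o, o, o, o, o, o, o, o, o, q 2 0, q 2 0],
  [o, o, o, o, o, o, o, o, o, o, q 2 2],
  [o, o, o, o, o, o, o, o, o, o, o, q (-2) (-2)],
  [],
  [],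
  [o, o, q 2 0],
  [o, o, o, q (-2) (0), q 2 0],
  [o, o, o, o, q (-2) (-2)],
  [o, o, o, o, o, q 2 2],
  [],
  []]

def wT_yy : List (List (ℤ × ℤ)) := [
  [o, q 2 1, q 0 1],
  [],
  [],
  [o, o, o, o, o, q 1 0],
  [o, o, o, o, o, q (1) (-1)],
  [],
  [],
  [o, o, o, o, o, o, o, o, o, q 1 0, q (0) (-1)],
  [o, o, o, o, o, o, o, o, o, q 3 0, q 0 1],
  [],
  [],
  []]

def wT_ss : List (List (ℤ × ℤ)) := [
  [],
  [],
  [],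
  [],
  [],
  [],
  [],
  [o, o, o, o, o, o, o, o, o, o, q (0) (-4)],
  [],
  [],
  [],
  []]


theorem nT_ok : allTrue (chkData nT_y nT_z nT_M1 nT_M1 nT_s nT_r nT_U1 nT_U1 nT_W1 nT_W1 nT_T1
    nT_T1 nT_yy nT_ss (p 0 6 27 0) (p 1 0 1 0) (p 0 0 0 (-216)) (p 0 0 1 0) o) = true := by
  decide +kernel

theorem xT_ok : allTrue (chkData xT_y xT_z xT_M1 xT_M2 xT_s xT_r xT_U1 xT_U2 xT_W1 xT_W2 xT_T1
    xT_T2 xT_yy xT_ss (q (-1) 0) (q 1 0) o (q 144 192) (q 96 0)) = true := by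
  decide +kernel

theorem wT_ok : allTrue (chkData wT_y wT_z wT_M1 wT_M1 wT_s wT_r wT_U1 wT_U1 wT_W1 wT_W1 wT_T1
    wT_T1 wT_yy wT_ss o (q 1 0) o (q 1 0) (q 2 0)) = true := by
  decide +kernel

theorem nT_data {K : Type*} [CommRing K] (ζ : K) (h : ζ ^ 2 + ζ + 1 = 0) (μ η : K) :
    ∃ y z M s r U W T : Matrix (Fin 12) (Fin 12) K,
      Data ζ y z M M s r U U W W T T (27 * η ^ 6) μ (-(216 * ζ)) 1 0 := by
  have H := data_of (evP_ev (evP_ev (evZ_ev ζ h) η) μ) _ _ _ _ _ _ _ _ _ _ _ _ _ _ _ _ _ _ _ nT_ok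
  simp [p, o, evP, evZ, Co.zero] at H
  have e : η * (η * (η * (η * (η * (η * 27))))) = 27 * η ^ 6 := by ring
  rw [e] at H
  exact ⟨_, _, _, _, _, _, _, _, H⟩

theorem xT_data {K : Type*} [CommRing K] (ζ : K) (h : ζ ^ 2 + ζ + 1 = 0) :
    ∃ y z M1 M2 s r U1 U2 W1 W2 T1 T2 : Matrix (Fin 12) (Fin 12) K,
      Data ζ y z M1 M2 s r U1 U2 W1 W2 T1 T2 (-1) 1 0 (144 + 192 * ζ) 96 := by
  have H := data_of (evZ_ev ζ h) _ _ _ _ _ _ _ _ _ _ _ _ _ _ _ _ _ _ _ xT_ok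
  simp [q, o, evZ, Co.zero] at H
  exact ⟨_, _, _, _, _, _, _, _, _, _, _, _, H⟩

theorem wT_data {K : Type*} [CommRing K] (ζ : K) (h : ζ ^ 2 + ζ + 1 = 0) :
    ∃ y z M s r U W T : Matrix (Fin 12) (Fin 12) K,
      Data ζ y z M M s r U U W W T T 0 1 0 1 2 := by
  have H := data_of (evZ_ev ζ h) _ _ _ _ _ _ _ _ _ _ _ _ _ _ _ _ _ _ _ wT_ok
  simp [q, o, evZ, Co.zero] at H
  exact ⟨_, _, _, _, _, _, _, _, H⟩


open scoped TensorProduct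

/-- The relations for `ε = 1`, written out. -/
structure Rel {K : Type*} [CommRing K] {B : Type*} [Ring B] [Algebra K B] (ζ : K)
    (y1 y2 y3 : B) (l1 l2 l3 l4 l5 mu : K) : Prop where
  r1 : y1 * y1 = l1 • (1 : B)
  r2 : y2 * y2 = l2 • (1 : B)
  r3 : y3 * y3 * y3 = l3 • (1 : B)
  r13 : y1 * y3 = y3 * y1
  rest : ∃ u w z s r t : B, y3 * y2 + y2 * y3 = u ∧ y3 * u + (-1 - ζ) • (u * y3) = w ∧
    y2 * y1 + y1 * y2 = z ∧ y3 * z + z * y3 = s ∧ y3 * s + (-1 - ζ) • (s * y3) = r ∧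
    u * s + ζ • (s * u) = t ∧ w * u + u * w = l4 • (1 : B) ∧ r * s + s * r = l5 • (1 : B) ∧
    z * z = mu • (1 : B) ∧ t * y2 = y2 * t

theorem tensor_rel {K : Type*} [CommRing K] {R C : Type*} [Ring R] [Algebra K R] [Ring C]
    [Algebra K C] {ζ : K} {y z M1 M2 s r U1 U2 W1 W2 T1 T2 : R} {l3 mu l5 c m4 : K}
    (D : Data ζ y z M1 M2 s r U1 U2 W1 W2 T1 T2 l3 mu l5 c m4)
    {e ψ θ1 θ2 : C} {l1 ν α κ : K} (τ : K)
    (hee : e * e = l1 • (1 : C)) (hψe : ψ * e = ν • (1 : C) - e * ψ) (hψψ : ψ * ψ = α • (1 : C))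
    (h1e : θ1 * e = - (e * θ1)) (h2e : θ2 * e = - (e * θ2))
    (h1ψ : θ1 * ψ = - (ψ * θ1)) (h2ψ : θ2 * ψ = - (ψ * θ2))
    (h11 : θ1 * θ1 = 0) (h22 : θ2 * θ2 = 0) (h21 : θ2 * θ1 = κ • (1 : C) - θ1 * θ2) :
    Rel ζ ((1 : R) ⊗ₜ[K] e) (z ⊗ₜ[K] ψ + M1 ⊗ₜ[K] θ1 + M2 ⊗ₜ[K] θ2) (τ • (y ⊗ₜ[K] (1 : C)))
      l1 (α * mu + κ * c) (τ ^ 3 * l3) (τ ^ 3 * (α * l5 + κ * m4)) (τ ^ 3 * ν ^ 2 * l5)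
      (ν ^ 2 * mu) := by
  have hss : s * s * z = z * (s * s) := by
    have h1 : s * z = z * s := by
      rw [← D.hs]
      have a1 : z * z * y = mu • y := by rw [D.zz]; simp
      have a2 : y * (z * z) = mu • y := by rw [D.zz]; simp
      rw [add_mul, mul_add, mul_assoc y, a2, ← mul_assoc z z, a1, mul_assoc, add_comm]
    rw [mul_assoc, h1, ← mul_assoc, h1, mul_assoc]
  have one_eq : (1 : R ⊗[K] C) = (1 : R) ⊗ₜ[K] (1 : C) := rfl
  constructor
  · rw [Algebra.TensorProduct.tmul_mul_tmul, hee, one_mul, TensorProduct.tmul_smul, one_eq]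
  · simp only [add_mul, mul_add, Algebra.TensorProduct.tmul_mul_tmul, hψψ, h1ψ, h2ψ, h11, h22, h21,
      D.zz, D.z1, D.z2, D.c12, D.c21, one_eq, TensorProduct.tmul_smul,
      TensorProduct.tmul_neg, TensorProduct.tmul_sub, TensorProduct.tmul_zero,
      ← TensorProduct.smul_tmul']
    module
  · simp only [smul_mul_assoc, mul_smul_comm, Algebra.TensorProduct.tmul_mul_tmul, D.y3, one_eq,
      mul_one, ← TensorProduct.smul_tmul']
    module
  · simp
  refine ⟨τ • (s ⊗ₜ[K] ψ + U1 ⊗ₜ[K] θ1 + U2 ⊗ₜ[K] θ2),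
    τ ^ 2 • (r ⊗ₜ[K] ψ + W1 ⊗ₜ[K] θ1 + W2 ⊗ₜ[K] θ2), ν • (z ⊗ₜ[K] (1 : C)),
    (τ * ν) • (s ⊗ₜ[K] (1 : C)), (τ ^ 2 * ν) • (r ⊗ₜ[K] (1 : C)),
    (τ ^ 2 * ν) • ((1 + ζ) • ((s * s) ⊗ₜ[K] ψ) + T1 ⊗ₜ[K] θ1 + T2 ⊗ₜ[K] θ2),
    ?_, ?_, ?_, ?_, ?_, ?_, ?_, ?_, ?_, ?_⟩
  · rw [← D.hs, ← D.hU1, ← D.hU2]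
    simp only [add_mul, mul_add, smul_mul_assoc, mul_smul_comm,
      Algebra.TensorProduct.tmul_mul_tmul, TensorProduct.add_tmul, mul_one, one_mul]
    module
  · rw [← D.hr, ← D.hW1, ← D.hW2]
    simp only [add_mul, mul_add, smul_mul_assoc, mul_smul_comm,
      Algebra.TensorProduct.tmul_mul_tmul, TensorProduct.add_tmul, mul_one, one_mul,
      ← TensorProduct.smul_tmul']
    module
  · simp only [add_mul, mul_add, Algebra.TensorProduct.tmul_mul_tmul, one_mul, mul_one,
      hψe, h1e, h2e, TensorProduct.tmul_sub, TensorProduct.tmul_smul, TensorProduct.tmul_neg]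
    module
  · rw [← D.hs]
    simp only [smul_mul_assoc, mul_smul_comm,
      Algebra.TensorProduct.tmul_mul_tmul, TensorProduct.add_tmul, mul_one]
    module
  · rw [← D.hr]
    simp only [smul_mul_assoc, mul_smul_comm,
      Algebra.TensorProduct.tmul_mul_tmul, TensorProduct.add_tmul, mul_one,
      ← TensorProduct.smul_tmul']
    module
  · rw [← D.hT1, ← D.hT2]
    simp only [add_mul, mul_add, smul_mul_assoc, mul_smul_comm,
      Algebra.TensorProduct.tmul_mul_tmul, TensorProduct.add_tmul, mul_one, one_mul,
      ← TensorProduct.smul_tmul']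
    module
  · have a1 := congrArg (fun x => x ⊗ₜ[K] (1 : C)) D.rs
    have a2 := congrArg (fun x => x ⊗ₜ[K] (ψ * θ1)) D.c1
    have a3 := congrArg (fun x => x ⊗ₜ[K] (ψ * θ2)) D.c2
    have a4 := congrArg (fun x => x ⊗ₜ[K] (θ1 * θ2)) D.m12
    have a5 := congrArg (fun x => x ⊗ₜ[K] (θ1 * θ2)) D.m21
    have a6 := congrArg (fun x => x ⊗ₜ[K] (1 : C)) D.m21
    simp only [TensorProduct.add_tmul, ← TensorProduct.smul_tmul'] at a1 a2 a3 a4 a5 a6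
    simp only [add_mul, mul_add, smul_mul_assoc, mul_smul_comm,
      Algebra.TensorProduct.tmul_mul_tmul, hψψ, h1ψ, h2ψ, h11, h22, h21, one_eq,
      TensorProduct.tmul_smul,
      TensorProduct.tmul_neg, TensorProduct.tmul_sub, TensorProduct.tmul_zero]
    linear_combination (norm := module) (τ ^ 3 * α) • a1 + (τ ^ 3) • a2 + (τ ^ 3) • a3 + (τ ^ 3) • a4
      - (τ ^ 3) • a5 + (τ ^ 3 * κ) • a6
  · have a1 := congrArg (fun x => x ⊗ₜ[K] (1 : C)) D.rs
    simp only [TensorProduct.add_tmul, ← TensorProduct.smul_tmul'] at a1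
    simp only [smul_mul_assoc, mul_smul_comm, Algebra.TensorProduct.tmul_mul_tmul, mul_one, one_eq]
    linear_combination (norm := module) (τ ^ 3 * ν ^ 2) • a1
  · simp only [smul_mul_assoc, mul_smul_comm, Algebra.TensorProduct.tmul_mul_tmul, D.zz, one_eq,
      mul_one, ← TensorProduct.smul_tmul']
    module
  · have a1 := congrArg (fun x => x ⊗ₜ[K] (1 : C)) hss
    have a2 := congrArg (fun x => x ⊗ₜ[K] (ψ * θ1)) D.d1
    have a3 := congrArg (fun x => x ⊗ₜ[K] (ψ * θ2)) D.d2
    have a4 := congrArg (fun x => x ⊗ₜ[K] (θ1 * θ2)) D.t12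
    have a5 := congrArg (fun x => x ⊗ₜ[K] (θ1 * θ2)) D.t21
    have a6 := congrArg (fun x => x ⊗ₜ[K] (1 : C)) D.t21
    simp only [TensorProduct.add_tmul, ← TensorProduct.smul_tmul'] at a1 a2 a3 a4 a5 a6
    simp only [add_mul, mul_add, smul_mul_assoc, mul_smul_comm,
      Algebra.TensorProduct.tmul_mul_tmul, hψψ, h1ψ, h2ψ, h11, h22, h21,
      TensorProduct.tmul_smul,
      TensorProduct.tmul_neg, TensorProduct.tmul_sub, TensorProduct.tmul_zero]
    linear_combination (norm := module) (τ ^ 2 * ν * (1 + ζ) * α) • a1 - (τ ^ 2 * ν) • a2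
      - (τ ^ 2 * ν) • a3 + (τ ^ 2 * ν) • a4 - (τ ^ 2 * ν) • a5 + (τ ^ 2 * ν * κ) • a6


/-- The relations for general `ε`, written out. -/
structure RelE {K : Type*} [CommRing K] {B : Type*} [Ring B] [Algebra K B] (ζ ε : K)
    (y1 y2 y3 : B) (l1 l2 l3 l4 l5 l6 : K) : Prop where
  r1 : y1 * y1 = l1 • (1 : B)
  r2 : y2 * y2 = l2 • (1 : B)
  r3 : y3 * y3 * y3 = l3 • (1 : B)
  r13 : y1 * y3 = y3 * y1
  r12 : (y1 * y2 - ε • (y2 * y1)) * (y1 * y2 - ε • (y2 * y1)) = l6 • (1 : B)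
  rest : ∃ u w z s r t : B, y3 * y2 + y2 * y3 = u ∧ y3 * u + (-1 - ζ) • (u * y3) = w ∧
    y2 * y1 + ε • (y1 * y2) = z ∧ y3 * z + z * y3 = s ∧ y3 * s + (-1 - ζ) • (s * y3) = r ∧
    u * s + (ε * ζ) • (s * u) = t ∧ w * u + u * w = l4 • (1 : B) ∧ r * s + s * r = l5 • (1 : B) ∧
    t * y2 = ε • (y2 * t)

theorem RelE.map {K : Type*} [CommRing K] {B B' : Type*} [Ring B] [Algebra K B] [Ring B']
    [Algebra K B'] {ζ ε : K} {y1 y2 y3 : B} {l1 l2 l3 l4 l5 l6 : K}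
    (H : RelE ζ ε y1 y2 y3 l1 l2 l3 l4 l5 l6) (f : B →ₐ[K] B') :
    RelE ζ ε (f y1) (f y2) (f y3) l1 l2 l3 l4 l5 l6 := by
  obtain ⟨u, w, z, s, r, t, h1, h2, h3, h4, h5, h6, h7, h8, h9⟩ := H.rest
  refine ⟨?_, ?_, ?_, ?_, ?_, f u, f w, f z, f s, f r, f t, ?_, ?_, ?_, ?_, ?_, ?_, ?_, ?_, ?_⟩
  · simpa using congrArg f H.r1
  · simpa using congrArg f H.r2
  · simpa using congrArg f H.r3
  · simpa using congrArg f H.r13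
  · simpa using congrArg f H.r12
  · simpa using congrArg f h1
  · simpa using congrArg f h2
  · simpa using congrArg f h3
  · simpa using congrArg f h4
  · simpa using congrArg f h5
  · simpa using congrArg f h6
  · simpa using congrArg f h7
  · simpa using congrArg f h8
  · simpa using congrArg f h9

theorem rel_sq {K : Type*} [CommRing K] {B : Type*} [Ring B] [Algebra K B] {ζ : K}
    {y1 y2 y3 : B} {l1 l2 l3 l4 l5 mu : K} (h : Rel ζ y1 y2 y3 l1 l2 l3 l4 l5 mu) :
    (y1 * y2 - y2 * y1) * (y1 * y2 - y2 * y1) = (mu - 4 * l1 * l2) • (1 : B) := by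
  obtain ⟨u, w, z, s, r, t, -, -, hz, -, -, -, -, -, hzz, -⟩ := h.rest
  have a1 : y1 * y2 * (y2 * y1) = (l1 * l2) • (1 : B) := by
    rw [mul_assoc, ← mul_assoc y2, h.r2, smul_mul_assoc, one_mul, mul_smul_comm, h.r1, smul_smul,
      mul_comm l2]
  have a2 : y2 * y1 * (y1 * y2) = (l1 * l2) • (1 : B) := by
    rw [mul_assoc, ← mul_assoc y1, h.r1, smul_mul_assoc, one_mul, mul_smul_comm, h.r2, smul_smul]
  rw [← hz] at hzz
  simp only [sub_mul, mul_sub, add_mul, mul_add] at hzz ⊢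
  rw [a1, a2] at *
  linear_combination (norm := module) hzz

theorem rel_pos {K : Type*} [CommRing K] {B : Type*} [Ring B] [Algebra K B] {ζ : K}
    {y1 y2 y3 : B} {l1 l2 l3 l4 l5 l6 : K}
    (h : Rel ζ y1 y2 y3 l1 l2 l3 l4 l5 (l6 + 4 * l1 * l2)) :
    RelE ζ 1 y1 y2 y3 l1 l2 l3 l4 l5 l6 := by
  have hv := rel_sq h
  obtain ⟨u, w, z, s, r, t, h1, h2, h3, h4, h5, h6, h7, h8, -, h9⟩ := h.rest
  refine ⟨h.r1, h.r2, h.r3, h.r13, ?_, u, w, z, s, r, t, h1, h2, ?_, h4, h5, ?_, h7, h8, ?_⟩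
  · rw [one_smul, hv]; congr 1; ring
  · rw [one_smul, h3]
  · rw [one_mul, h6]
  · rw [one_smul, h9]

theorem rel_neg {K : Type*} [CommRing K] {B C : Type*} [Ring B] [Algebra K B] [Ring C]
    [Algebra K C] {ζ : K}
    {y1 y2 y3 : B} {l1 l2 l3 l4 l5 l6 : K} {σ ρ : C} (hσ : σ * σ = 1) (hρ : ρ * ρ = 1)
    (hσρ : σ * ρ = - (ρ * σ))
    (h : Rel ζ y1 y2 y3 l1 l2 l3 l4 (-l5) (-l6 + 4 * l1 * l2)) :
    RelE ζ (-1) (y1 ⊗ₜ[K] σ) (y2 ⊗ₜ[K] ρ) (y3 ⊗ₜ[K] (1 : C)) l1 l2 l3 l4 l5 l6 := by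
  have hv := rel_sq h
  have one_eq : (1 : B ⊗[K] C) = (1 : B) ⊗ₜ[K] (1 : C) := rfl
  have hJJ : ρ * σ * (ρ * σ) = -1 := by
    rw [mul_assoc, ← mul_assoc σ, hσρ, neg_mul, mul_neg, mul_assoc, hσ, mul_one, hρ]
  have hρJ : ρ * (ρ * σ) = σ := by rw [← mul_assoc, hρ, one_mul]
  have hJρ : ρ * σ * ρ = -σ := by rw [mul_assoc, hσρ, mul_neg, hρJ]
  obtain ⟨u, w, z, s, r, t, h1, h2, h3, h4, h5, h6, h7, h8, -, h9⟩ := h.rest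
  refine ⟨?_, ?_, ?_, ?_, ?_, u ⊗ₜ[K] ρ, w ⊗ₜ[K] ρ, z ⊗ₜ[K] (ρ * σ), s ⊗ₜ[K] (ρ * σ),
    r ⊗ₜ[K] (ρ * σ), t ⊗ₜ[K] σ, ?_, ?_, ?_, ?_, ?_, ?_, ?_, ?_, ?_⟩
  · rw [Algebra.TensorProduct.tmul_mul_tmul, hσ, h.r1, one_eq, TensorProduct.smul_tmul']
  · rw [Algebra.TensorProduct.tmul_mul_tmul, hρ, h.r2, one_eq, TensorProduct.smul_tmul']
  · simp only [Algebra.TensorProduct.tmul_mul_tmul, mul_one]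
    rw [h.r3, one_eq, TensorProduct.smul_tmul']
  · simp only [Algebra.TensorProduct.tmul_mul_tmul, mul_one, one_mul]
    rw [h.r13]
  · have e : y1 ⊗ₜ[K] σ * y2 ⊗ₜ[K] ρ - (-1 : K) • (y2 ⊗ₜ[K] ρ * y1 ⊗ₜ[K] σ)
        = -((y1 * y2 - y2 * y1) ⊗ₜ[K] (ρ * σ)) := by
      simp only [Algebra.TensorProduct.tmul_mul_tmul, hσρ, TensorProduct.sub_tmul,
        TensorProduct.tmul_neg]
      module
    rw [e, neg_mul_neg, Algebra.TensorProduct.tmul_mul_tmul, hv, hJJ, TensorProduct.tmul_neg,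
      ← TensorProduct.smul_tmul', one_eq]
    module
  · rw [← h1]
    simp only [Algebra.TensorProduct.tmul_mul_tmul, mul_one, one_mul, TensorProduct.add_tmul]
  · rw [← h2]
    simp only [Algebra.TensorProduct.tmul_mul_tmul, mul_one, one_mul, TensorProduct.add_tmul,
      TensorProduct.smul_tmul']
  · rw [← h3]
    simp only [Algebra.TensorProduct.tmul_mul_tmul, hσρ, TensorProduct.add_tmul,
      TensorProduct.tmul_neg]
    module
  · rw [← h4]
    simp only [Algebra.TensorProduct.tmul_mul_tmul, mul_one, one_mul, TensorProduct.add_tmul]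
  · rw [← h5]
    simp only [Algebra.TensorProduct.tmul_mul_tmul, mul_one, one_mul, TensorProduct.add_tmul,
      TensorProduct.smul_tmul']
  · rw [← h6]
    simp only [Algebra.TensorProduct.tmul_mul_tmul, hρJ, hJρ, TensorProduct.add_tmul,
      ← TensorProduct.smul_tmul', TensorProduct.tmul_neg]
    module
  · simp only [Algebra.TensorProduct.tmul_mul_tmul, hρ, ← TensorProduct.add_tmul, h7, one_eq,
      TensorProduct.smul_tmul']
  · have a := congrArg (fun x => x ⊗ₜ[K] (1 : C)) h8
    simp only [TensorProduct.add_tmul, ← TensorProduct.smul_tmul'] at a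
    simp only [Algebra.TensorProduct.tmul_mul_tmul, hJJ, one_eq, TensorProduct.tmul_neg]
    linear_combination (norm := module) -a
  · simp only [Algebra.TensorProduct.tmul_mul_tmul, h9, hσρ, TensorProduct.tmul_neg]
    module

set_option maxHeartbeats 4000000 in
theorem cliff {K : Type*} [CommRing K] (l1 ν b κ : K) :
    ∃ e ψ θ1 θ2 : Matrix (Fin 4) (Fin 4) K,
      e * e = l1 • (1 : Matrix (Fin 4) (Fin 4) K) ∧
      ψ * e = ν • (1 : Matrix (Fin 4) (Fin 4) K) - e * ψ ∧
      ψ * ψ = (b ^ 2) • (1 : Matrix (Fin 4) (Fin 4) K) ∧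
      θ1 * e = - (e * θ1) ∧ θ2 * e = - (e * θ2) ∧ θ1 * ψ = - (ψ * θ1) ∧ θ2 * ψ = - (ψ * θ2) ∧
      θ1 * θ1 = 0 ∧ θ2 * θ2 = 0 ∧ θ2 * θ1 = κ • (1 : Matrix (Fin 4) (Fin 4) K) - θ1 * θ2 := by
  refine ⟨!![0, 1, 0, 0; l1, 0, 0, 0; 0, 0, 0, -1; 0, 0, -l1, 0],
    !![b, 0, 0, 0; ν, -b, 0, 0; 0, 0, -b, 0; 0, 0, -ν, b],
    !![0, 0, κ, 0; 0, 0, 0, κ; 0, 0, 0, 0; 0, 0, 0, 0],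
    !![0, 0, 0, 0; 0, 0, 0, 0; 1, 0, 0, 0; 0, 1, 0, 0], ?_, ?_, ?_, ?_, ?_, ?_, ?_, ?_, ?_, ?_⟩ <;>
  · ext i j
    fin_cases i <;> fin_cases j <;>
      simp [Matrix.mul_apply, Fin.sum_univ_four] <;> ring

theorem mk_rel {K : Type*} [Field K] [IsAlgClosed K] {ζ : K}
    {y z M1 M2 s r U1 U2 W1 W2 T1 T2 : Matrix (Fin 12) (Fin 12) K} {l3 mu l5 c m4 : K}
    (D : Data ζ y z M1 M2 s r U1 U2 W1 W2 T1 T2 l3 mu l5 c m4) (l1 ν α κ τ : K) :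
    ∃ y1 y2 y3 : Matrix (Fin 12) (Fin 12) K ⊗[K] Matrix (Fin 4) (Fin 4) K,
      Rel ζ y1 y2 y3 l1 (α * mu + κ * c) (τ ^ 3 * l3) (τ ^ 3 * (α * l5 + κ * m4))
        (τ ^ 3 * ν ^ 2 * l5) (ν ^ 2 * mu) := by
  obtain ⟨b, hb⟩ := IsAlgClosed.exists_pow_nat_eq α (n := 2) (by norm_num)
  obtain ⟨e, ψ, θ1, θ2, h1, h2, h3, h4, h5, h6, h7, h8, h9, h10⟩ := cliff l1 ν b κ
  rw [hb] at h3
  exact ⟨_, _, _, tensor_rel D τ h1 h2 h3 h4 h5 h6 h7 h8 h9 h10⟩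

theorem exists_rel {K : Type*} [Field K] [IsAlgClosed K] [CharZero K] (ζ : K)
    (h : ζ ^ 2 + ζ + 1 = 0) (l1 l2 l3 l4 l5 mu : K) :
    ∃ y1 y2 y3 : Matrix (Fin 12) (Fin 12) K ⊗[K] Matrix (Fin 4) (Fin 4) K,
      Rel ζ y1 y2 y3 l1 l2 l3 l4 l5 mu := by
  have hζ : ζ ≠ 0 := by rintro rfl; simp at h
  by_cases h5 : l5 = 0
  · subst h5
    obtain ⟨ν, hν⟩ := IsAlgClosed.exists_pow_nat_eq mu (n := 2) (by norm_num)
    by_cases h3 : l3 = 0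
    · subst h3
      obtain ⟨y, z, M, s, r, U, W, T, D⟩ := wT_data ζ h
      obtain ⟨y1, y2, y3, H⟩ := mk_rel D l1 ν (l2 - l4 / 2) (l4 / 2) 1
      refine ⟨y1, y2, y3, ?_⟩
      rw [hν] at H
      convert H using 1 <;> ring
    · obtain ⟨y, z, M1, M2, s, r, U1, U2, W1, W2, T1, T2, D⟩ := xT_data ζ h
      obtain ⟨τ, hτ⟩ := IsAlgClosed.exists_pow_nat_eq (-l3) (n := 3) (by norm_num)
      obtain ⟨y1, y2, y3, H⟩ := mk_rel D l1 ν (l2 - l4 / (-l3 * 96) * (144 + 192 * ζ))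
        (l4 / (-l3 * 96)) τ
      refine ⟨y1, y2, y3, ?_⟩
      rw [hτ, hν] at H
      convert H using 1 <;> first | ring1 | (field_simp; done) | (field_simp; ring1)
  · have hz : -(216 * ζ) ≠ 0 := by simp [hζ]
    obtain ⟨τ, hτ⟩ := IsAlgClosed.exists_pow_nat_eq (l5 / (-(216 * ζ))) (n := 3) (by norm_num)
    have hτ0 : τ ^ 3 ≠ 0 := by rw [hτ]; exact div_ne_zero h5 hz
    obtain ⟨η, hη⟩ := IsAlgClosed.exists_pow_nat_eq (l3 / (27 * τ ^ 3)) (n := 6) (by norm_num)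
    obtain ⟨y, z, M, s, r, U, W, T, D⟩ := nT_data ζ h mu η
    obtain ⟨y1, y2, y3, H⟩ := mk_rel D l1 1 (l4 / l5) (l2 - l4 / l5 * mu) τ
    refine ⟨y1, y2, y3, ?_⟩
    have e5 : τ ^ 3 * (-(216 * ζ)) = l5 := by rw [hτ]; exact div_mul_cancel₀ _ hz
    have e3 : τ ^ 3 * (27 * η ^ 6) = l3 := by 
      have h27 : (27 : K) * τ ^ 3 ≠ 0 := mul_ne_zero (by norm_num) hτ0
      rw [← mul_assoc, mul_comm (τ ^ 3), hη, mul_div_cancel₀ _ h27]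
    have e4 : τ ^ 3 * (l4 / l5 * -(216 * ζ) + (l2 - l4 / l5 * mu) * 0) = l4 := by
      rw [mul_zero, add_zero, mul_left_comm, e5, div_mul_cancel₀ _ h5]
    rw [e3, e4, one_pow, mul_one (τ ^ 3), e5, one_mul] at H
    convert H using 1
    ring

/-- A nontrivial algebra with elements satisfying the relations. -/
theorem exists_relE {K : Type*} [Field K] [IsAlgClosed K] [CharZero K] (ζ : K)
    (h : ζ ^ 2 + ζ + 1 = 0) (ε : K) (hε : ε = 1 ∨ ε = -1) (l1 l2 l3 l4 l5 l6 : K) :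
    ∃ y1 y2 y3 : (Matrix (Fin 12) (Fin 12) K ⊗[K] Matrix (Fin 4) (Fin 4) K) ⊗[K]
      Matrix (Fin 2) (Fin 2) K, RelE ζ ε y1 y2 y3 l1 l2 l3 l4 l5 l6 := by
  rcases hε with rfl | rfl
  · obtain ⟨y1, y2, y3, H⟩ := exists_rel ζ h l1 l2 l3 l4 l5 (l6 + 4 * l1 * l2)
    have H' := rel_pos H
    exact ⟨_, _, _, H'.map (Algebra.TensorProduct.includeLeft (S := K))⟩
  · obtain ⟨y1, y2, y3, H⟩ := exists_rel ζ h l1 l2 l3 l4 (-l5) (-l6 + 4 * l1 * l2)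
    refine ⟨_, _, _, rel_neg (σ := !![0, 1; 1, 0]) (ρ := !![1, 0; 0, -1]) ?_ ?_ ?_ H⟩
    · simp [Matrix.one_fin_two]
    · simp [Matrix.one_fin_two]
    · simp



theorem bcF {k : Type*} [Field k] {B : Type*} [Ring B] [Algebra k B] (ε i x : k)
    (f : FreeAlgebra k (Fin 3) →ₐ[k] B) (q : Fin 3 → Fin 3 → k)
    (hq : q = ![![-1, ε, 1], ![-ε, -1, i], ![1, -1, i]])
    {a b : FreeAlgebra k (Fin 3) × (Fin 3 → ℕ)} {a' b' : B} {a0 a1 a2 b0 b1 b2 : ℕ}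
    (ha : f a.1 = a' ∧ a.2 = ![a0, a1, a2]) (hb : f b.1 = b' ∧ b.2 = ![b0, b1, b2])
    (hx : (-1) ^ (a0 * b0) * ε ^ (a0 * b1) * ((-ε) ^ (a1 * b0) * (-1) ^ (a1 * b1) * i ^ (a1 * b2)) *
      ((-1) ^ (a2 * b1) * i ^ (a2 * b2)) = x) :
    f (bc q a b).1 = a' * b' - x • (b' * a') ∧
      (bc q a b).2 = ![a0 + b0, a1 + b1, a2 + b2] := by
  constructor
  · have : qForm q a.2 b.2 = x := by
      rw [← hx, ha.2, hb.2, hq]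
      simp [qForm, Fin.prod_univ_three]
    simp only [bc, this, map_sub, map_mul, map_smul, ha.1, hb.1]
  · simp only [bc, ha.2, hb.2]
    ext j
    fin_cases j <;> rfl

theorem final {k : Type*} [Field k] {B : Type*} [Ring B] [Algebra k B] [Nontrivial B]
    (ζ : k) (h : ζ ^ 2 + ζ + 1 = 0) (ε : k) (hεε : ε * ε = 1)
    (lam₁ lam₂ lam₃ lam₄ lam₅ lam₆ : k) (y1 y2 y3 : B)
    (H : RelE ζ ε y1 y2 y3 lam₁ lam₂ lam₃ lam₄ lam₅ lam₆)
    (q : Fin 3 → Fin 3 → k) (hq : q = ![![-1, ε, 1], ![-ε, -1, ζ⁻¹], ![1, -1, ζ⁻¹]]) :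
    (1 : FreeAlgebra k (Fin 3)) ∉ TwoSidedIdeal.span
      ({FreeAlgebra.ι k (0 : Fin 3) ^ 2 - algebraMap k (FreeAlgebra k (Fin 3)) lam₁,
        FreeAlgebra.ι k (1 : Fin 3) ^ 2 - algebraMap k (FreeAlgebra k (Fin 3)) lam₂,
        FreeAlgebra.ι k (2 : Fin 3) ^ 3 - algebraMap k (FreeAlgebra k (Fin 3)) lam₃,
        (bc q (bc q (ygen k 2) (bc q (ygen k 2) (ygen k 1))) (bc q (ygen k 2) (ygen k 1))).1 - algebraMap k (FreeAlgebra k (Fin 3)) lam₄,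
        (bc q (bc q (ygen k 2) (bc q (ygen k 2) (bc q (ygen k 1) (ygen k 0)))) (bc q (ygen k 2) (bc q (ygen k 1) (ygen k 0)))).1 - algebraMap k (FreeAlgebra k (Fin 3)) lam₅,
        (bc q (ygen k 0) (ygen k 2)).1,
        (bc q (ygen k 0) (ygen k 1)).1 ^ 2 - algebraMap k (FreeAlgebra k (Fin 3)) lam₆,
        (bc q (bc q (bc q (ygen k 2) (ygen k 1)) (bc q (ygen k 2) (bc q (ygen k 1) (ygen k 0)))) (ygen k 1)).1} : Set (FreeAlgebra k (Fin 3))) := by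
  have hinv : ζ⁻¹ = -1 - ζ := by
    apply inv_eq_of_mul_eq_one_right
    linear_combination -h
  rw [hinv] at hq
  obtain ⟨u, w, z, s, r, t, h1, h2, h3, h4, h5, h6, h7, h8, h9⟩ := H.rest
  let f : FreeAlgebra k (Fin 3) →ₐ[k] B := FreeAlgebra.lift k ![y1, y2, y3]
  have f0 : f (FreeAlgebra.ι k 0) = y1 := by simp [f]
  have f1 : f (FreeAlgebra.ι k 1) = y2 := by simp [f]
  have f2 : f (FreeAlgebra.ι k 2) = y3 := by simp [f]
  have g0 : f (ygen k (0 : Fin 3)).1 = y1 ∧ (ygen k (0 : Fin 3)).2 = ![1, 0, 0] :=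
    ⟨f0, by ext j; fin_cases j <;> rfl⟩
  have g1 : f (ygen k (1 : Fin 3)).1 = y2 ∧ (ygen k (1 : Fin 3)).2 = ![0, 1, 0] :=
    ⟨f1, by ext j; fin_cases j <;> rfl⟩
  have g2 : f (ygen k (2 : Fin 3)).1 = y3 ∧ (ygen k (2 : Fin 3)).2 = ![0, 0, 1] :=
    ⟨f2, by ext j; fin_cases j <;> rfl⟩
  clear_value f
  have g21 := bcF ε _ (-ε) f q hq g1 g0 (by norm_num)
  have g12 := bcF ε _ ε f q hq g0 g1 (by norm_num)
  have g13 := bcF ε _ 1 f q hq g0 g2 (by norm_num)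
  have g32 := bcF ε _ (-1) f q hq g2 g1 (by norm_num)
  have e1 : y3 * y2 - (-1 : k) • (y2 * y3) = u := by rw [← h1]; module
  have e2 : y2 * y1 - (-ε) • (y1 * y2) = z := by rw [← h3]; module
  rw [e1] at g32
  rw [e2] at g21
  have g332 := bcF ε _ (1 + ζ) f q hq g2 g32 (by norm_num; ring)
  have g321 := bcF ε _ (-1) f q hq g2 g21 (by norm_num)
  have e3 : y3 * u - (1 + ζ) • (u * y3) = w := by rw [← h2]; module
  have e4 : y3 * z - (-1 : k) • (z * y3) = s := by rw [← h4]; module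
  rw [e3] at g332
  rw [e4] at g321
  have g3321 := bcF ε _ (1 + ζ) f q hq g2 g321 (by norm_num; ring)
  have e5 : y3 * s - (1 + ζ) • (s * y3) = r := by rw [← h5]; module
  rw [e5] at g3321
  have k4 := bcF ε _ (-1) f q hq g332 g32 (by norm_num; grind)
  have k5 := bcF ε _ (-1) f q hq g3321 g321 (by norm_num; grind)
  have kt := bcF ε _ (-(ε * ζ)) f q hq g32 g321 (by norm_num; grind)
  have e6 : u * s - (-(ε * ζ)) • (s * u) = t := by rw [← h6]; module
  rw [e6] at kt
  have k8 := bcF ε _ ε f q hq kt g1 (by norm_num)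
  intro hmem
  have hker : ∀ x, f x = 0 → x ∈ (TwoSidedIdeal.ker f : Set (FreeAlgebra k (Fin 3))) :=
    fun x hx => (TwoSidedIdeal.mem_ker f).2 hx
  have hle := (TwoSidedIdeal.mem_span_iff.1 hmem) (TwoSidedIdeal.ker f) (by
    intro x hx
    apply hker
    simp only [Set.mem_insert_iff, Set.mem_singleton_iff] at hx
    rcases hx with rfl | rfl | rfl | rfl | rfl | rfl | rfl | rfl
    · rw [map_sub, map_pow, f0, AlgHom.commutes, pow_two, H.r1, Algebra.algebraMap_eq_smul_one,
        sub_self]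
    · rw [map_sub, map_pow, f1, AlgHom.commutes, pow_two, H.r2, Algebra.algebraMap_eq_smul_one,
        sub_self]
    · rw [map_sub, map_pow, f2, AlgHom.commutes, pow_three', H.r3, Algebra.algebraMap_eq_smul_one,
        sub_self]
    · rw [map_sub, k4.1, AlgHom.commutes, Algebra.algebraMap_eq_smul_one, ← h7]
      module
    · rw [map_sub, k5.1, AlgHom.commutes, Algebra.algebraMap_eq_smul_one, ← h8]
      module
    · rw [g13.1, H.r13, one_smul, sub_self]
    · rw [map_sub, map_pow, g12.1, AlgHom.commutes, pow_two, H.r12, Algebra.algebraMap_eq_smul_one,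
        sub_self]
    · rw [k8.1, h9, sub_self])
  have h0 := (TwoSidedIdeal.mem_ker f).1 hle
  rw [map_one] at h0
  exact one_ne_zero h0

end Ufo


theorem statement_16 {k : Type*} [Field k] [IsAlgClosed k] [CharZero k]
    (ζ : k) (hζ : IsPrimitiveRoot ζ 3) (ε : k) (hε : ε = 1 ∨ ε = -1)
    (lam₁ lam₂ lam₃ lam₄ lam₅ lam₆ : k)
    (q : Fin 3 → Fin 3 → k) (hq : q = ![![-1, ε, 1], ![-ε, -1, ζ⁻¹], ![1, -1, ζ⁻¹]]) :
    (1 : FreeAlgebra k (Fin 3)) ∉ TwoSidedIdeal.span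
      ({FreeAlgebra.ι k (0 : Fin 3) ^ 2 - algebraMap k (FreeAlgebra k (Fin 3)) lam₁,
        FreeAlgebra.ι k (1 : Fin 3) ^ 2 - algebraMap k (FreeAlgebra k (Fin 3)) lam₂,
        FreeAlgebra.ι k (2 : Fin 3) ^ 3 - algebraMap k (FreeAlgebra k (Fin 3)) lam₃,
        (bc q (bc q (ygen k 2) (bc q (ygen k 2) (ygen k 1))) (bc q (ygen k 2) (ygen k 1))).1 - algebraMap k (FreeAlgebra k (Fin 3)) lam₄,
        (bc q (bc q (ygen k 2) (bc q (ygen k 2) (bc q (ygen k 1) (ygen k 0)))) (bc q (ygen k 2) (bc q (ygen k 1) (ygen k 0)))).1 - algebraMap k (FreeAlgebra k (Fin 3)) lam₅,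
        (bc q (ygen k 0) (ygen k 2)).1,
        (bc q (ygen k 0) (ygen k 1)).1 ^ 2 - algebraMap k (FreeAlgebra k (Fin 3)) lam₆,
        (bc q (bc q (bc q (ygen k 2) (ygen k 1)) (bc q (ygen k 2) (bc q (ygen k 1) (ygen k 0)))) (ygen k 1)).1} : Set (FreeAlgebra k (Fin 3))) := by

  have hζ3 : ζ ^ 3 = 1 := hζ.pow_eq_one
  have h : ζ ^ 2 + ζ + 1 = 0 := by
    have h1 : ζ ≠ 1 := hζ.ne_one (by norm_num)
    have h2 : (ζ - 1) * (ζ ^ 2 + ζ + 1) = 0 := by linear_combination hζ3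
    exact (mul_eq_zero.1 h2).resolve_left (sub_ne_zero.2 h1)
  obtain ⟨y1, y2, y3, H⟩ := Ufo.exists_relE ζ h ε hε lam₁ lam₂ lam₃ lam₄ lam₅ lam₆
  have hεε : ε * ε = 1 := by rcases hε with rfl | rfl <;> ring
  exact Ufo.final ζ h ε hεε lam₁ lam₂ lam₃ lam₄ lam₅ lam₆ y1 y2 y3 H q hq
end

section
/- Let k be an algebraically closed field of characteristic 0, ζ ∈ k a primitive 3rd root of unity, and b ∈ k a nonzero scalar. Let the 3×3 braiding matrix be q_{11} = −1, q_{12} = b, q_{13} = b⁻³, q_{21} = ζb⁻¹, q_{22} = −1, q_{23} = −ζb², q_{31} = b³, q_{32} = −b⁻², q_{33} = −1 (type 𝔤(2,3), second Weyl-groupoid object). Then for every λ ∈ k, the quotient of the free algebra k⟨y_1,y_2,y_3⟩ by the two-sided ideal generated by y_{13}, y_1², y_2², y_3², [[y_{32}, y_{321}]_c, y_2]_c, and [[y_{12}, y_{(13)}]_c, y_2]_c − λ is a nontrivial algebra. -/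
/-- The cyclic six-dimensional representation: `y₂, y₁, y₂, y₁, y₂, y₃` move cyclically
through the six basis vectors, the arrow of `y₃` carrying the weight `lam`. -/
def repY (k : Type*) [Field k] (lam : k) : Fin 3 → Module.End k (Fin 6 → k) :=
  ![{ toFun := fun f => ![0, f 2, 0, f 4, 0, 0]
      map_add' := by intro f g; ext i; fin_cases i <;> simp
      map_smul' := by intro c f; ext i; fin_cases i <;> simp },
    { toFun := fun f => ![f 1, 0, f 3, 0, f 5, 0]
      map_add' := by intro f g; ext i; fin_cases i <;> simp
      map_smul' := by intro c f; ext i; fin_cases i <;> simp },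
    { toFun := fun f => ![0, 0, 0, 0, 0, lam * f 0]
      map_add' := by intro f g; ext i; fin_cases i <;> simp [mul_add]
      map_smul' := by intro c f; ext i; fin_cases i <;> simp [mul_left_comm] }]

theorem repY_zero {k : Type*} [Field k] (lam : k) (f : Fin 6 → k) :
    repY k lam 0 f = ![0, f 2, 0, f 4, 0, 0] := rfl

theorem repY_one {k : Type*} [Field k] (lam : k) (f : Fin 6 → k) :
    repY k lam 1 f = ![f 1, 0, f 3, 0, f 5, 0] := rfl

theorem repY_two {k : Type*} [Field k] (lam : k) (f : Fin 6 → k) :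
    repY k lam 2 f = ![0, 0, 0, 0, 0, lam * f 0] := rfl

set_option maxHeartbeats 4000000 in
theorem statement_19 {k : Type*} [Field k] [IsAlgClosed k] [CharZero k]
    (ζ : k) (hζ : IsPrimitiveRoot ζ 3) (b : k) (hb : b ≠ 0)
    (lam : k)
    (q : Fin 3 → Fin 3 → k) (hq : q = ![![-1, b, (b ^ 3)⁻¹], ![ζ * b⁻¹, -1, -ζ * b ^ 2], ![b ^ 3, -(b ^ 2)⁻¹, -1]]) :
    (1 : FreeAlgebra k (Fin 3)) ∉ TwoSidedIdeal.span
      ({(bc q (ygen k 0) (ygen k 2)).1,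
        FreeAlgebra.ι k (0 : Fin 3) ^ 2,
        FreeAlgebra.ι k (1 : Fin 3) ^ 2,
        FreeAlgebra.ι k (2 : Fin 3) ^ 2,
        (bc q (bc q (bc q (ygen k 2) (ygen k 1)) (bc q (ygen k 2) (bc q (ygen k 1) (ygen k 0)))) (ygen k 1)).1,
        (bc q (bc q (bc q (ygen k 0) (ygen k 1)) (bc q (ygen k 0) (bc q (ygen k 1) (ygen k 2)))) (ygen k 1)).1 - algebraMap k (FreeAlgebra k (Fin 3)) lam} : Set (FreeAlgebra k (Fin 3))) := by
  have hz3 : ζ ^ 3 = 1 := hζ.pow_eq_one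
  have hz1 : ζ ≠ 1 := hζ.ne_one (by norm_num)
  have hz2 : ζ ^ 2 = -1 - ζ := by
    have h : (ζ - 1) * (ζ ^ 2 + ζ + 1) = 0 := by linear_combination hz3
    have h2 := (mul_eq_zero.mp h).resolve_left (sub_ne_zero.mpr hz1)
    linear_combination h2
  let φ : FreeAlgebra k (Fin 3) →ₐ[k] Module.End k (Fin 6 → k) := FreeAlgebra.lift k (repY k lam)
  have hφ : ∀ i, φ (FreeAlgebra.ι k i) = repY k lam i := fun i => FreeAlgebra.lift_ι_apply _ _
  intro h1
  have key : ∀ S : Set (FreeAlgebra k (Fin 3)), (1 : FreeAlgebra k (Fin 3)) ∈ TwoSidedIdeal.span S →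
      (∀ x ∈ S, φ x = 0) → False := by
    intro S hS h
    have hle : TwoSidedIdeal.span S ≤ TwoSidedIdeal.ker φ :=
      TwoSidedIdeal.span_le.mpr fun x hx => (TwoSidedIdeal.mem_ker φ).mpr (h x hx)
    have h := (TwoSidedIdeal.mem_ker φ).mp (hle hS)
    rw [map_one] at h
    exact one_ne_zero h
  · refine key _ h1 ?_
    rintro x hx
    simp only [Set.mem_insert_iff, Set.mem_singleton_iff] at hx
    have hext : ∀ A : Module.End k (Fin 6 → k), (∀ f, A f = 0) → A = 0 :=
      fun A h => LinearMap.ext h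
    rcases hx with rfl | rfl | rfl | rfl | rfl | rfl <;> apply hext <;> intro f <;>
      simp [bc, ygen, qForm, Fin.prod_univ_three, hφ, hq, repY_zero, repY_one, repY_two, pow_two]
    simp only [Matrix.vecHead, Matrix.vecTail, Function.comp_apply, Pi.smul_apply, smul_eq_mul]
    have e1 : b * b * (b⁻¹ * b⁻¹) = 1 := by field_simp
    have e2 : b * (b ^ 3)⁻¹ = b⁻¹ * b⁻¹ := by field_simp
    have e3 : b * b⁻¹ = 1 := mul_inv_cancel₀ hb
    rw [e1, e2]
    generalize b⁻¹ = c at *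
    refine ⟨?_, ?_, ?_, ?_, ?_, ?_⟩
    · change 1 * (lam * f 0) - lam * f 0 = 0
      ring
    · change lam * f 1 - lam * f 1 = 0
      ring
    · change _ - lam * f 2 = 0
      linear_combination (-lam * f 2) * hz2 + (-ζ * lam * f 2 * (b * c + 1)
        - ζ ^ 2 * lam * f 2 * (b ^ 2 * c ^ 2 + b * c + 1)) * e3
    · change _ - lam * f 3 = 0
      linear_combination (-lam * f 3) * hz2 + (-ζ * lam * f 3 * (b * c + 1)
        - ζ ^ 2 * lam * f 3 * (b ^ 2 * c ^ 2 + b * c + 1)) * e3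
    · change _ - lam * f 4 = 0
      linear_combination (lam * f 4) * hz3 + (ζ ^ 3 * lam * f 4 *
        (b ^ 4 * c ^ 4 + b ^ 3 * c ^ 3 + b ^ 2 * c ^ 2 + b * c + 1)) * e3
    · change _ - lam * f 5 = 0
      linear_combination (lam * f 5) * hz3 + (ζ ^ 3 * lam * f 5 *
        (b ^ 4 * c ^ 4 + b ^ 3 * c ^ 3 + b ^ 2 * c ^ 2 + b * c + 1)) * e3
end
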